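/- arXiv:2401.00397 — 10 statements merged into one kernel-verified Lean document; each statement's English description precedes it below -/
import Mathlib

section
/- Let γ > 0 and λ > 0, and let T be a monotone set-valued operator on H whose warped resolvents J_{γT}^M and J_{(γ+λ)T}^M both exist. Then for every x ∈ H, T_{γ+λ}^M x = T_γ^M ( x − λ M⁻¹ (T_{γ+λ}^M x) ); that is, the warped Yosida regularization of T with parameter γ+λ equals the warped Yosida regularization with parameter λ of the operator T_γ^M. -/
open scoped RealInnerProductSpace

/-- For `γ, λ > 0` and a monotone set-valued operator `T` on a real Hilbert
space `H` whose warped resolvents `Jg = J_{γT}^M` and `Jgl = J_{(γ+λ)T}^M` exist,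
for every `x ∈ H`, `T_{γ+λ}^M x = T_γ^M (x − λ M⁻¹ (T_{γ+λ}^M x))`. -/
theorem stmt_2
    {H : Type*} [NormedAddCommGroup H] [InnerProductSpace ℝ H] [CompleteSpace H]
    (M : H →L[ℝ] H) (hMsa : IsSelfAdjoint M)
    {c : ℝ} (hc : 0 < c) (hM : ∀ z : H, c * ‖z‖ ^ 2 ≤ ⟪M z, z⟫)
    (Minv : H →L[ℝ] H) (hMinv : ∀ z : H, Minv (M z) = z ∧ M (Minv z) = z)
    (T : Set (H × H))
    (hTmono : ∀ p ∈ T, ∀ q ∈ T, (0 : ℝ) ≤ ⟪p.1 - q.1, p.2 - q.2⟫)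
    {γ lam : ℝ} (hγ : 0 < γ) (hlam : 0 < lam)
    (Jg : H → H) (hJg : ∀ x : H, (Jg x, γ⁻¹ • (M x - M (Jg x))) ∈ T)
    (Jgl : H → H) (hJgl : ∀ x : H, (Jgl x, (γ + lam)⁻¹ • (M x - M (Jgl x))) ∈ T)
    (x : H) :
    ∀ u : H, u = (γ + lam)⁻¹ • (M x - M (Jgl x)) →
      u = γ⁻¹ • (M (x - lam • Minv u) - M (Jg (x - lam • Minv u))) := by
  intro u hu
  have hsum : γ + lam ≠ 0 := by positivity
  have hp : (Jgl x, u) ∈ T := by rw [hu]; exact hJgl x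
  have hu' : (γ + lam) • u = M x - M (Jgl x) := by
    rw [hu, smul_smul, mul_inv_cancel₀ hsum, one_smul]
  have hMy : M (x - lam • Minv u) = γ • u + M (Jgl x) := by
    rw [map_sub, map_smul, (hMinv u).2]
    have hx : M x = (γ + lam) • u + M (Jgl x) := by rw [hu']; abel
    rw [hx, add_smul]; abel
  have hq := hJg (x - lam • Minv u)
  set q := Jg (x - lam • Minv u) with hqdef
  rw [hMy] at hq ⊢
  have hv : γ⁻¹ • (γ • u + M (Jgl x) - M q) = u + γ⁻¹ • M (Jgl x - q) := by
    rw [add_sub_assoc, smul_add, smul_smul, inv_mul_cancel₀ hγ.ne', one_smul, map_sub]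
  rw [hv] at hq ⊢
  have hm := hTmono _ hp _ hq
  have h1 : u - (u + γ⁻¹ • M (Jgl x - q)) = -(γ⁻¹ • M (Jgl x - q)) := by abel
  simp only [h1, inner_neg_right, inner_smul_right] at hm
  rw [real_inner_comm] at hm
  have hg : 0 < γ⁻¹ := inv_pos.mpr hγ
  have h2 : ⟪M (Jgl x - q), Jgl x - q⟫ ≤ 0 := by
    by_contra hcon
    push Not at hcon
    have := mul_pos hg hcon
    linarith
  have h3 : ‖Jgl x - q‖ ^ 2 ≤ 0 := by
    by_contra hcon
    push Not at hcon
    have := mul_pos hc hcon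
    have := hM (Jgl x - q)
    linarith
  have h4 : Jgl x - q = 0 := by
    have : ‖Jgl x - q‖ = 0 := by
      have := le_antisymm h3 (sq_nonneg _)
      simpa using this
    exact norm_eq_zero.mp this
  rw [h4]; simp
end

section
/- Let γ > 0 and let T be a maximally monotone set-valued operator on H whose warped resolvent J_{γT}^M exists. Then T_γ^M is γ-cocoercive with respect to M: for all x₁, x₂ ∈ H, γ ⟨M⁻¹(T_γ^M x₁ − T_γ^M x₂), T_γ^M x₁ − T_γ^M x₂⟩ ≤ ⟨x₁ − x₂, T_γ^M x₁ − T_γ^M x₂⟩. Consequently T_γ^M is Lipschitz continuous: there exists L > 0 with ‖T_γ^M x₁ − T_γ^M x₂‖ ≤ L ‖x₁ − x₂‖ for all x₁, x₂ ∈ H. -/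
open scoped RealInnerProductSpace

/-- For `γ > 0` and a maximally monotone set-valued operator `T` on a real
Hilbert space `H` whose warped resolvent `J = J_{γT}^M` exists, the warped Yosida
regularization `T_γ^M x = γ⁻¹ (M x − M (J x))` is `γ`-cocoercive with respect to `M` and
Lipschitz continuous. -/
theorem stmt_3
    {H : Type*} [NormedAddCommGroup H] [InnerProductSpace ℝ H] [CompleteSpace H]
    (M : H →L[ℝ] H) (hMsa : IsSelfAdjoint M)
    {c : ℝ} (hc : 0 < c) (hM : ∀ z : H, c * ‖z‖ ^ 2 ≤ ⟪M z, z⟫)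
    (Minv : H →L[ℝ] H) (hMinv : ∀ z : H, Minv (M z) = z ∧ M (Minv z) = z)
    (T : Set (H × H))
    (hTmono : ∀ p ∈ T, ∀ q ∈ T, (0 : ℝ) ≤ ⟪p.1 - q.1, p.2 - q.2⟫)
    (hTmax : ∀ p : H × H, (∀ q ∈ T, (0 : ℝ) ≤ ⟪p.1 - q.1, p.2 - q.2⟫) → p ∈ T)
    {γ : ℝ} (hγ : 0 < γ)
    (J : H → H) (hJ : ∀ x : H, (J x, γ⁻¹ • (M x - M (J x))) ∈ T) :
    (∀ x₁ x₂ : H,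
      γ * ⟪Minv (γ⁻¹ • (M x₁ - M (J x₁)) - γ⁻¹ • (M x₂ - M (J x₂))),
            γ⁻¹ • (M x₁ - M (J x₁)) - γ⁻¹ • (M x₂ - M (J x₂))⟫
        ≤ ⟪x₁ - x₂, γ⁻¹ • (M x₁ - M (J x₁)) - γ⁻¹ • (M x₂ - M (J x₂))⟫) ∧
    (∃ L : ℝ, 0 < L ∧ ∀ x₁ x₂ : H,
      ‖γ⁻¹ • (M x₁ - M (J x₁)) - γ⁻¹ • (M x₂ - M (J x₂))‖ ≤ L * ‖x₁ - x₂‖) := by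
  have key : ∀ x₁ x₂ : H, γ⁻¹ • (M x₁ - M (J x₁)) - γ⁻¹ • (M x₂ - M (J x₂))
      = γ⁻¹ • M ((x₁ - x₂) - (J x₁ - J x₂)) := by
    intro x₁ x₂
    rw [← smul_sub]
    simp only [map_sub]
    congr 1
    abel
  have mono : ∀ x₁ x₂ : H, ⟪(x₁ - x₂) - (J x₁ - J x₂),
      γ⁻¹ • M ((x₁ - x₂) - (J x₁ - J x₂))⟫
      ≤ ⟪x₁ - x₂, γ⁻¹ • M ((x₁ - x₂) - (J x₁ - J x₂))⟫ := by
    intro x₁ x₂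
    have h := hTmono _ (hJ x₁) _ (hJ x₂)
    simp only [key] at h
    rw [inner_sub_left (x₁ - x₂)]
    linarith
  simp only [key]
  refine ⟨fun x₁ x₂ => ?_, γ⁻¹ * ‖M‖ * (‖M‖ / c) + 1, by positivity, fun x₁ x₂ => ?_⟩
  · refine le_trans (le_of_eq ?_) (mono x₁ x₂)
    rw [map_smul, (hMinv _).1, real_inner_smul_left, ← mul_assoc,
      mul_inv_cancel₀ hγ.ne', one_mul]
  · have h := mono x₁ x₂
    generalize (x₁ - x₂) - (J x₁ - J x₂) = w at h ⊢
    generalize x₁ - x₂ = x at h ⊢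
    rw [real_inner_smul_right, real_inner_smul_right] at h
    have h1 := le_of_mul_le_mul_left h (inv_pos.2 hγ)
    rw [real_inner_comm] at h1
    have h2 := hM w
    have h3 := real_inner_le_norm x (M w)
    have h4 := M.le_opNorm w
    have h5 : ‖x‖ * ‖M w‖ ≤ ‖x‖ * (‖M‖ * ‖w‖) := by gcongr
    have h6 : ‖w‖ ≤ ‖M‖ / c * ‖x‖ := by
      rw [div_mul_eq_mul_div, le_div_iff₀ hc]
      rcases (norm_nonneg w).eq_or_lt with h0 | h0
      · rw [← h0, zero_mul]; positivity
      · refine le_of_mul_le_mul_right ?_ h0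
        nlinarith
    rw [norm_smul, Real.norm_of_nonneg (inv_pos.2 hγ).le]
    calc γ⁻¹ * ‖M w‖ ≤ γ⁻¹ * (‖M‖ * (‖M‖ / c * ‖x‖)) := by
          gcongr
          exact h4.trans (by gcongr)
      _ ≤ _ := by nlinarith [norm_nonneg x]
end

section
/- Let T be a maximally monotone set-valued operator on H with nonempty domain D(T) = {x : T x ≠ ∅}, and suppose the warped resolvent J_{γT}^M exists for every γ ∈ (0,1). Fix x ∈ H and set x_γ = J_{γT}^M x. Then, as γ → 0⁺, x_γ converges strongly to P^M_{cl D(T)} x, the unique point of the closed convex set cl D(T) (the norm-closure of D(T)) minimizing y ↦ ‖x − y‖_M over cl D(T). -/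
open scoped RealInnerProductSpace

/-- Let `T` be maximally monotone with nonempty domain, and let the warped
resolvents `J γ = J_{γT}^M` exist for every `γ ∈ (0,1)`. Then, for fixed `x`, as
`γ → 0⁺` the net `J γ x` converges strongly to the unique point of the norm-closure of
the domain of `T` that minimizes `y ↦ ‖x − y‖_M` over that closure. -/
theorem stmt_5
    {H : Type*} [NormedAddCommGroup H] [InnerProductSpace ℝ H] [CompleteSpace H]
    (M : H →L[ℝ] H) (hMsa : IsSelfAdjoint M)
    {c : ℝ} (hc : 0 < c) (hM : ∀ z : H, c * ‖z‖ ^ 2 ≤ ⟪M z, z⟫)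
    (T : Set (H × H))
    (hTmono : ∀ p ∈ T, ∀ q ∈ T, (0 : ℝ) ≤ ⟪p.1 - q.1, p.2 - q.2⟫)
    (hTmax : ∀ p : H × H, (∀ q ∈ T, (0 : ℝ) ≤ ⟪p.1 - q.1, p.2 - q.2⟫) → p ∈ T)
    (hdom : ∃ z u : H, (z, u) ∈ T)
    (J : ℝ → H → H)
    (hJ : ∀ γ : ℝ, 0 < γ → γ < 1 →
      ∀ x : H, (J γ x, γ⁻¹ • (M x - M (J γ x))) ∈ T)
    (x : H) :
    ∃ p : H, p ∈ closure {z : H | ∃ u : H, (z, u) ∈ T} ∧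
      (∀ y ∈ closure {z : H | ∃ u : H, (z, u) ∈ T},
        Real.sqrt ⟪x - p, M (x - p)⟫ ≤ Real.sqrt ⟪x - y, M (x - y)⟫) ∧
      (∀ q ∈ closure {z : H | ∃ u : H, (z, u) ∈ T},
        (∀ y ∈ closure {z : H | ∃ u : H, (z, u) ∈ T},
          Real.sqrt ⟪x - q, M (x - q)⟫ ≤ Real.sqrt ⟪x - y, M (x - y)⟫) → q = p) ∧
      Filter.Tendsto (fun γ : ℝ => J γ x) (nhdsWithin 0 (Set.Ioo 0 1)) (nhds p) := by
  have hS : ∀ a b : H, ⟪a, M b⟫ = ⟪b, M a⟫ := by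
    intro a b
    have h := hMsa.isSymmetric a b
    simp only [ContinuousLinearMap.coe_coe] at h
    rw [← h, real_inner_comm]
  have hpos : ∀ z : H, c * ‖z‖ ^ 2 ≤ ⟪z, M z⟫ := by
    intro z
    rw [real_inner_comm]
    exact hM z
  have hpos0 : ∀ z : H, 0 ≤ ⟪z, M z⟫ := fun z => le_trans (by positivity) (hpos z)
  -- parallelogram-type identity
  have hid : ∀ a b : H, ⟪b - a, M (b - a)⟫ = ⟪a, M a⟫ - ⟪b, M b⟫ + 2 * ⟪b - a, M b⟫ := by
    intro a b
    simp only [map_sub, inner_sub_left, inner_sub_right]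
    rw [hS b a]
    ring
  -- the key monotonicity inequality
  have key : ∀ γ : ℝ, 0 < γ → γ < 1 → ∀ z u : H, (z, u) ∈ T →
      ⟪z - J γ x, M (x - J γ x)⟫ ≤ γ * ⟪z - J γ x, u⟫ := by
    intro γ h0 h1 z u hzu
    have h := hTmono _ hzu _ (hJ γ h0 h1 x)
    simp only at h
    rw [inner_sub_right, inner_smul_right, ← map_sub] at h
    have h2 := mul_nonneg h0.le h
    rw [mul_sub, ← mul_assoc, mul_inv_cancel₀ h0.ne', one_mul] at h2
    linarith
  -- boundedness
  obtain ⟨z₀, u₀, hz₀⟩ := hdom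
  obtain ⟨B, hB⟩ : ∃ B : ℝ, ∀ γ : ℝ, 0 < γ → γ < 1 → ‖J γ x‖ ≤ B := by
    refine ⟨‖z₀‖ + (‖u₀‖ + ‖M (x - z₀)‖) / c, fun γ h0 h1 => ?_⟩
    have h := key γ h0 h1 z₀ u₀ hz₀
    have hp := hpos (z₀ - J γ x)
    have e : ⟪z₀ - J γ x, M (z₀ - J γ x)⟫
        = ⟪z₀ - J γ x, M (x - J γ x)⟫ - ⟪z₀ - J γ x, M (x - z₀)⟫ := by
      rw [← inner_sub_right, ← map_sub]
      congr 2
      abel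
    have h3 : |⟪z₀ - J γ x, u₀⟫| ≤ ‖z₀ - J γ x‖ * ‖u₀‖ := abs_real_inner_le_norm _ _
    have h4 : |⟪z₀ - J γ x, M (x - z₀)⟫| ≤ ‖z₀ - J γ x‖ * ‖M (x - z₀)‖ :=
      abs_real_inner_le_norm _ _
    have h5 : γ * ⟪z₀ - J γ x, u₀⟫ ≤ ‖z₀ - J γ x‖ * ‖u₀‖ := by
      calc γ * ⟪z₀ - J γ x, u₀⟫ ≤ γ * (‖z₀ - J γ x‖ * ‖u₀‖) :=
            mul_le_mul_of_nonneg_left ((le_abs_self _).trans h3) h0.le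
        _ ≤ 1 * (‖z₀ - J γ x‖ * ‖u₀‖) := mul_le_mul_of_nonneg_right h1.le (by positivity)
        _ = _ := one_mul _
    have h6 := (neg_abs_le _).trans' (neg_le_neg h4)
    have h7 : ‖z₀ - J γ x‖ ≤ (‖u₀‖ + ‖M (x - z₀)‖) / c := by
      rw [le_div_iff₀ hc]
      rcases (norm_nonneg (z₀ - J γ x)).eq_or_lt with h8 | h8
      · rw [← h8, zero_mul]; positivity
      · refine le_of_mul_le_mul_left ?_ h8
        nlinarith
    have h9 : ‖J γ x‖ ≤ ‖z₀‖ + ‖z₀ - J γ x‖ := by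
      have := norm_sub_le z₀ (z₀ - J γ x)
      rwa [sub_sub_cancel] at this
    linarith
  have hIoo : ∀ᶠ γ : ℝ in nhdsWithin 0 (Set.Ioo 0 1), γ ∈ Set.Ioo (0:ℝ) 1 :=
    eventually_mem_nhdsWithin
  have hid0 : Filter.Tendsto (fun γ : ℝ => γ) (nhdsWithin 0 (Set.Ioo 0 1)) (nhds 0) :=
    tendsto_nhdsWithin_of_tendsto_nhds Filter.tendsto_id
  haveI hne : (nhdsWithin (0:ℝ) (Set.Ioo 0 1)).NeBot :=
    mem_closure_iff_nhdsWithin_neBot.1 (by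
      rw [closure_Ioo (by norm_num : (0:ℝ) ≠ 1)]; constructor <;> norm_num)
  -- uniform version of the key inequality
  have key2 : ∀ γ : ℝ, 0 < γ → γ < 1 → ∀ z u : H, (z, u) ∈ T →
      ⟪z - J γ x, M (x - J γ x)⟫ ≤ γ * ((‖z‖ + B) * ‖u‖) := by
    intro γ h0 h1 z u hzu
    refine (key γ h0 h1 z u hzu).trans (mul_le_mul_of_nonneg_left ?_ h0.le)
    refine (real_inner_le_norm _ _).trans (mul_le_mul_of_nonneg_right ?_ (norm_nonneg _))
    exact (norm_sub_le _ _).trans (by linarith [hB γ h0 h1])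
  -- Cauchy
  have hcau : Cauchy (Filter.map (fun γ : ℝ => J γ x) (nhdsWithin 0 (Set.Ioo 0 1))) := by
    rw [Metric.cauchy_iff]
    refine ⟨Filter.map_neBot, fun ε hε => ?_⟩
    set f : ℝ → ℝ := fun γ => ⟪x - J γ x, M (x - J γ x)⟫ with hf
    have hbdd : BddBelow (f '' Set.Ioo 0 1) := ⟨0, by
      rintro _ ⟨γ, -, rfl⟩; exact hpos0 _⟩
    have hnon : (f '' Set.Ioo 0 1).Nonempty := ⟨_, 1/2, by constructor <;> norm_num, rfl⟩
    set η : ℝ := c * (ε / 2) ^ 2 / 2 with hη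
    have hηpos : 0 < η := by positivity
    obtain ⟨_, ⟨δ, hδ, rfl⟩, hlt⟩ := exists_lt_of_csInf_lt hnon
      (lt_add_of_pos_right (sInf (f '' Set.Ioo 0 1)) hηpos)
    set K : ℝ := (‖J δ x‖ + B) * ‖δ⁻¹ • (M x - M (J δ x))‖ with hK
    have hsmall : ∀ᶠ γ : ℝ in nhdsWithin 0 (Set.Ioo 0 1), 2 * (γ * K) < η := by
      have : Filter.Tendsto (fun γ : ℝ => 2 * (γ * K)) (nhdsWithin 0 (Set.Ioo 0 1))
          (nhds (2 * (0 * K))) := (hid0.mul_const K).const_mul 2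
      rw [zero_mul, mul_zero] at this
      exact this.eventually_lt_const hηpos
    refine ⟨Metric.ball (J δ x) (ε / 2), ?_, fun a ha b hb => ?_⟩
    · rw [Filter.mem_map]
      filter_upwards [hIoo, hsmall] with γ hγ hs
      have h1 := key2 γ hγ.1 hγ.2 _ _ (hJ δ hδ.1 hδ.2 x)
      have h2 := hid (x - J δ x) (x - J γ x)
      rw [sub_sub_sub_cancel_left] at h2
      have h3 : sInf (f '' Set.Ioo 0 1) ≤ f γ := csInf_le hbdd ⟨γ, hγ, rfl⟩
      have h4 := hpos (J δ x - J γ x)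
      simp only [hf] at h3 hlt
      have h5 : c * ‖J δ x - J γ x‖ ^ 2 < c * (ε / 2) ^ 2 := by
        have : c * (ε / 2) ^ 2 = 2 * η := by rw [hη]; ring
        linarith
      have h6 := lt_of_mul_lt_mul_left h5 hc.le
      have h7 := lt_of_pow_lt_pow_left₀ 2 (by positivity) h6
      rw [Set.mem_preimage, Metric.mem_ball, dist_comm, dist_eq_norm]
      exact h7
    · have := dist_triangle_right a b (J δ x)
      rw [Metric.mem_ball] at ha hb
      linarith
  obtain ⟨p, hp⟩ := CompleteSpace.complete hcau
  have hp : Filter.Tendsto (fun γ : ℝ => J γ x) (nhdsWithin 0 (Set.Ioo 0 1)) (nhds p) := hp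
  -- variational inequality
  have hvar : ∀ y ∈ closure {z : H | ∃ u : H, (z, u) ∈ T}, ⟪y - p, M (x - p)⟫ ≤ 0 := by
    have hcl : IsClosed {y : H | ⟪y - p, M (x - p)⟫ ≤ 0} :=
      isClosed_le (by fun_prop) continuous_const
    refine fun y hy => closure_minimal ?_ hcl hy
    rintro z ⟨u, hzu⟩
    have hl : Filter.Tendsto (fun γ : ℝ => ⟪z - J γ x, M (x - J γ x)⟫)
        (nhdsWithin 0 (Set.Ioo 0 1)) (nhds ⟪z - p, M (x - p)⟫) :=
      (tendsto_const_nhds.sub hp).inner ((M.continuous.tendsto _).comp (tendsto_const_nhds.sub hp))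
    have hr := hid0.mul_const ((‖z‖ + B) * ‖u‖)
    rw [zero_mul] at hr
    refine le_of_tendsto_of_tendsto hl hr ?_
    filter_upwards [hIoo] with γ hγ
    exact key2 γ hγ.1 hγ.2 z u hzu
  have hmain : ∀ y ∈ closure {z : H | ∃ u : H, (z, u) ∈ T},
      ⟪x - p, M (x - p)⟫ + c * ‖y - p‖ ^ 2 ≤ ⟪x - y, M (x - y)⟫ := by
    intro y hy
    have h1 := hvar y hy
    have h2 := hid (x - y) (x - p)
    rw [sub_sub_sub_cancel_left] at h2
    have := hpos (y - p)
    linarith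
  have hpm : p ∈ closure {z : H | ∃ u : H, (z, u) ∈ T} := by
    refine mem_closure_of_tendsto hp ?_
    filter_upwards [hIoo] with γ hγ
    exact ⟨_, hJ γ hγ.1 hγ.2 x⟩
  refine ⟨p, hpm, fun y hy => Real.sqrt_le_sqrt ?_, fun q hq hmin => ?_, hp⟩
  · have := hmain y hy
    have : 0 ≤ c * ‖y - p‖ ^ 2 := by positivity
    linarith
  · have h1 := (Real.sqrt_le_sqrt_iff (hpos0 _)).1 (hmin p hpm)
    have h2 := hmain q hq
    have h3 : c * ‖q - p‖ ^ 2 ≤ 0 := by linarith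
    have h4 : ‖q - p‖ ^ 2 ≤ 0 := by
      by_contra hcon
      push Not at hcon
      have := mul_pos hc hcon
      linarith
    have h5 : ‖q - p‖ = 0 := by
      have := sq_nonneg ‖q - p‖
      exact pow_eq_zero_iff (two_ne_zero) |>.1 (le_antisymm h4 this)
    exact sub_eq_zero.1 (norm_eq_zero.1 h5)
end

section
/- Let γ > 0, let T be a maximally monotone set-valued operator on H whose warped resolvent J_{γT}^M exists, and assume T⁻¹(0) = {z : (z,0) ∈ G(T)} is nonempty. Let u : [0,∞) → H be continuously differentiable with u′(t) = −T_γ^M(u(t)) for all t ≥ 0. Then there exists u* ∈ T⁻¹(0) such that u(t) converges weakly to u* as t → ∞ (i.e. ⟨u(t), w⟩ → ⟨u*, w⟩ for every w ∈ H). -/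
open scoped RealInnerProductSpace
open Filter


section Aux
variable {H : Type*} [NormedAddCommGroup H] [InnerProductSpace ℝ H]

lemma aux_antitone (f f' : ℝ → ℝ) (s : Set ℝ) (hs : Convex ℝ s)
    (hf : ∀ t ∈ s, HasDerivAt f (f' t) t) (hf' : ∀ t ∈ s, f' t ≤ 0) : AntitoneOn f s := by
  refine antitoneOn_of_deriv_nonpos hs (fun t ht => (hf t ht).continuousAt.continuousWithinAt) ?_ ?_
  · intro t ht
    exact (hf t (interior_subset ht)).differentiableAt.differentiableWithinAt
  · intro t ht
    rw [(hf t (interior_subset ht)).deriv]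
    exact hf' t (interior_subset ht)

lemma aux_sq_deriv (v : ℝ → H) (v' : H) (t : ℝ) (h : HasDerivAt v v' t) :
    HasDerivAt (fun t => ‖v t‖ ^ 2) (2 * ⟪v t, v'⟫) t := h.norm_sq

/-- differences of trajectories contract -/
lemma aux_contract (A : H → H) (hA : ∀ x y, 0 ≤ ⟪x - y, A x - A y⟫)
    (u v : ℝ → H) (hu : ∀ t, 0 ≤ t → HasDerivAt u (-(A (u t))) t)
    (hv : ∀ t, 0 ≤ t → HasDerivAt v (-(A (v t))) t) :
    AntitoneOn (fun t => ‖u t - v t‖ ^ 2) (Set.Ici 0) := by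
  refine aux_antitone _ (fun t => 2 * ⟪u t - v t, -(A (u t)) - -(A (v t))⟫) _ (convex_Ici 0)
    (fun t ht => aux_sq_deriv _ _ t ((hu t ht).sub (hv t ht))) ?_
  intro t _
  have h := hA (u t) (v t)
  have e : -(A (u t)) - -(A (v t)) = -(A (u t) - A (v t)) := by abel
  simp only [e, inner_neg_right]
  linarith

lemma aux_speed (A : H → H) (hA : ∀ x y, 0 ≤ ⟪x - y, A x - A y⟫)
    (u : ℝ → H) (hu : ∀ t, 0 ≤ t → HasDerivAt u (-(A (u t))) t)
    {s t : ℝ} (hs : 0 ≤ s) (hst : s ≤ t) : ‖A (u t)‖ ≤ ‖A (u s)‖ := by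
  have key : ∀ r, 0 ≤ r → Tendsto (fun h : ℝ => ‖h⁻¹ • (u (r + h) - u r)‖)
      (nhdsWithin 0 (Set.Ioi 0)) (nhds ‖A (u r)‖) := by
    intro r hr
    have h1 := (hu r hr).tendsto_slope_zero_right.norm
    rwa [norm_neg] at h1
  refine le_of_tendsto_of_tendsto (key t (hs.trans hst)) (key s hs) ?_
  filter_upwards [self_mem_nhdsWithin] with h hh
  have hh : 0 < h := hh
  have := aux_contract A hA (fun r => u (r + h)) u
    (fun r hr => (hu (r + h) (by linarith)).comp_add_const r h) hu
    (Set.mem_Ici.2 hs) (Set.mem_Ici.2 (hs.trans hst)) hst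
  have h2 := (sq_le_sq₀ (norm_nonneg _) (norm_nonneg _)).1 this
  rw [norm_smul, norm_smul]
  exact mul_le_mul_of_nonneg_left h2 (norm_nonneg _)

lemma aux_to_zero (A : H → H) {κ : ℝ} (hκ : 0 < κ)
    (hA : ∀ x y, κ * ‖A x - A y‖ ^ 2 ≤ ⟪x - y, A x - A y⟫)
    (u : ℝ → H) (hu : ∀ t, 0 ≤ t → HasDerivAt u (-(A (u t))) t) (z : H) (hz : A z = 0) :
    Tendsto (fun t => ‖A (u t)‖) atTop (nhds 0) := by
  have hA0 : ∀ x y, 0 ≤ ⟪x - y, A x - A y⟫ := fun x y => le_trans (by positivity) (hA x y)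
  have bound : ∀ R : ℝ, 0 < R → ‖A (u R)‖ ^ 2 ≤ (‖u 0 - z‖ ^ 2 / (2 * κ)) / R := by
    intro R hR
    have hanti : AntitoneOn (fun t => ‖u t - z‖ ^ 2 + 2 * κ * ‖A (u R)‖ ^ 2 * t) (Set.Icc 0 R) := by
      refine aux_antitone _ (fun t => 2 * ⟪u t - z, -(A (u t))⟫ + 2 * κ * ‖A (u R)‖ ^ 2 * 1) _
        (convex_Icc 0 R)
        (fun t ht => (aux_sq_deriv _ _ t ((hu t ht.1).sub_const z)).add
          ((hasDerivAt_id t).const_mul _)) ?_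
      intro t ht
      have h1 := hA (u t) z
      rw [hz, sub_zero] at h1
      have h2 := aux_speed A hA0 u hu ht.1 ht.2
      have h3 : ‖A (u R)‖ ^ 2 ≤ ‖A (u t)‖ ^ 2 := by gcongr
      have h4 := mul_le_mul_of_nonneg_left h3 hκ.le
      simp only [inner_neg_right]
      linarith
    have := hanti (Set.left_mem_Icc.2 hR.le) (Set.right_mem_Icc.2 hR.le) hR.le
    simp only [mul_zero, add_zero] at this
    rw [div_div, le_div_iff₀ (by positivity)]
    nlinarith [sq_nonneg ‖u R - z‖]
  have hsq : Tendsto (fun t => ‖A (u t)‖ ^ 2) atTop (nhds 0) := by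
    refine tendsto_of_tendsto_of_tendsto_of_le_of_le' tendsto_const_nhds
      (tendsto_id.const_div_atTop (‖u 0 - z‖ ^ 2 / (2 * κ))) 
      (Eventually.of_forall fun t => sq_nonneg _) ?_
    filter_upwards [eventually_gt_atTop 0] with t ht using bound t ht
  have := hsq.sqrt
  simpa [Real.sqrt_sq] using this

lemma aux_conv (f : ℝ → ℝ) (hf : AntitoneOn f (Set.Ici 0)) (h0 : ∀ t, 0 ≤ f t) :
    ∃ L, Tendsto f atTop (nhds L) := by
  have hanti : Antitone (fun t => f (max t 0)) := fun a b hab =>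
    hf (Set.mem_Ici.2 (le_max_right _ _)) (Set.mem_Ici.2 (le_max_right _ _)) (max_le_max_right 0 hab)
  refine ⟨_, (tendsto_atTop_ciInf hanti ⟨0, ?_⟩).congr' ?_⟩
  · rintro _ ⟨t, rfl⟩
    exact h0 _
  · filter_upwards [eventually_ge_atTop 0] with t ht
    rw [max_eq_left ht]

lemma aux_weak [CompleteSpace H] (u : ℝ → H) (B : ℝ) (hB : ∀ t, 0 ≤ t → ‖u t‖ ≤ B)
    (U : Ultrafilter ℝ) (hU : (U : Filter ℝ) ≤ atTop) :
    ∃ x : H, ∀ w : H, Tendsto (fun t => ⟪u t, w⟫) U (nhds ⟪x, w⟫) := by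
  let F : ℝ → WeakDual ℝ H := fun t => StrongDual.toWeakDual (InnerProductSpace.toDual ℝ H (u t))
  have hcomp := WeakDual.isCompact_closedBall (𝕜 := ℝ) (E := H) 0 B
  have hmem : (U.map F : Filter (WeakDual ℝ H)) ≤
      Filter.principal (WeakDual.toStrongDual ⁻¹' Metric.closedBall (0 : StrongDual ℝ H) B) := by
    rw [le_principal_iff]
    refine hU ?_
    filter_upwards [eventually_ge_atTop 0] with t ht
    have : ‖InnerProductSpace.toDual ℝ H (u t)‖ ≤ B := by
      rw [LinearIsometryEquiv.norm_map]; exact hB t ht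
    simpa [F] using this
  obtain ⟨l, -, hl⟩ := hcomp.ultrafilter_le_nhds _ hmem
  refine ⟨(InnerProductSpace.toDual ℝ H).symm (WeakDual.toStrongDual l), fun w => ?_⟩
  have h1 : Tendsto F U (nhds l) := hl
  have h2 := ((WeakDual.eval_continuous w).tendsto l).comp h1
  rw [InnerProductSpace.toDual_symm_apply]
  exact h2

end Aux

/-- Let `γ > 0`, `T` maximally monotone with a zero, `J = J_{γT}^M` its
warped resolvent, and let `u : [0,∞) → H` be a continuously differentiable solution of
`u′(t) = −T_γ^M(u(t))`. Then `u(t)` converges weakly, as `t → ∞`, to some zero `u*`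
of `T`. -/
theorem stmt_9
    {H : Type*} [NormedAddCommGroup H] [InnerProductSpace ℝ H] [CompleteSpace H]
    (M : H →L[ℝ] H) (hMsa : IsSelfAdjoint M)
    {c : ℝ} (hc : 0 < c) (hM : ∀ z : H, c * ‖z‖ ^ 2 ≤ ⟪M z, z⟫)
    (T : Set (H × H))
    (hTmono : ∀ p ∈ T, ∀ q ∈ T, (0 : ℝ) ≤ ⟪p.1 - q.1, p.2 - q.2⟫)
    (hTmax : ∀ p : H × H, (∀ q ∈ T, (0 : ℝ) ≤ ⟪p.1 - q.1, p.2 - q.2⟫) → p ∈ T)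
    (hzero : ∃ z : H, (z, (0 : H)) ∈ T)
    {γ : ℝ} (hγ : 0 < γ)
    (J : H → H) (hJ : ∀ x : H, (J x, γ⁻¹ • (M x - M (J x))) ∈ T)
    (u : ℝ → H) (hC1 : ContDiffOn ℝ 1 u (Set.Ici 0))
    (hu : ∀ t : ℝ, 0 ≤ t →
      HasDerivAt u (-(γ⁻¹ • (M (u t) - M (J (u t))))) t) :
    ∃ us : H, (us, (0 : H)) ∈ T ∧
      ∀ w : H, Tendsto (fun t : ℝ => ⟪u t, w⟫) atTop (nhds ⟪us, w⟫) := by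
  obtain ⟨z₀, hz₀⟩ := hzero
  set A : H → H := fun x => γ⁻¹ • (M x - M (J x)) with hAdef
  have hγ' : 0 < γ⁻¹ := inv_pos.2 hγ
  have hAM : ∀ x, A x = γ⁻¹ • M (x - J x) := fun x => by simp [hAdef]
  have hAlow : ∀ x y, γ⁻¹ * c * ‖(x - J x) - (y - J y)‖ ^ 2 ≤ ⟪x - y, A x - A y⟫ := by
    intro x y
    have h1 : 0 ≤ ⟪J x - J y, A x - A y⟫ := hTmono _ (hJ x) _ (hJ y)
    have h2 := hM ((x - J x) - (y - J y))
    have e1 : x - y = (J x - J y) + ((x - J x) - (y - J y)) := by abel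
    have e2 : A x - A y = γ⁻¹ • M ((x - J x) - (y - J y)) := by
      rw [hAM, hAM, ← smul_sub, ← map_sub]
    have h3 : ⟪(x - J x) - (y - J y), A x - A y⟫
        = γ⁻¹ * ⟪M ((x - J x) - (y - J y)), (x - J x) - (y - J y)⟫ := by
      rw [e2, inner_smul_right, real_inner_comm]
    have h4 := mul_le_mul_of_nonneg_left h2 hγ'.le
    have h5 : ⟪x - y, A x - A y⟫ = ⟪J x - J y, A x - A y⟫
        + ⟪(x - J x) - (y - J y), A x - A y⟫ := by
      rw [← inner_add_left, ← e1]
    rw [h5, h3]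
    linarith
  have hKpos : 0 < γ⁻¹ * ‖M‖ + 1 := by positivity
  set K := γ⁻¹ * ‖M‖ + 1 with hK
  have hAup : ∀ x y, ‖A x - A y‖ ≤ K * ‖(x - J x) - (y - J y)‖ := by
    intro x y
    have e2 : A x - A y = γ⁻¹ • M ((x - J x) - (y - J y)) := by
      rw [hAM, hAM, ← smul_sub, ← map_sub]
    rw [e2, norm_smul, Real.norm_of_nonneg hγ'.le]
    have := mul_le_mul_of_nonneg_left (M.le_opNorm ((x - J x) - (y - J y))) hγ'.le
    have := norm_nonneg ((x - J x) - (y - J y))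
    rw [hK]
    linarith
  have hκ : 0 < γ⁻¹ * c / K ^ 2 := by positivity
  have hA : ∀ x y, γ⁻¹ * c / K ^ 2 * ‖A x - A y‖ ^ 2 ≤ ⟪x - y, A x - A y⟫ := by
    intro x y
    refine le_trans ?_ (hAlow x y)
    have h1 : ‖A x - A y‖ ^ 2 ≤ (K * ‖(x - J x) - (y - J y)‖) ^ 2 := by
      gcongr; exact hAup x y
    calc _ ≤ γ⁻¹ * c / K ^ 2 * (K * ‖(x - J x) - (y - J y)‖) ^ 2 := by gcongr
      _ = _ := by field_simp
  have hA0 : ∀ x y, 0 ≤ ⟪x - y, A x - A y⟫ := fun x y => le_trans (by positivity) (hA x y)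
  have hZ : ∀ z, (z, (0 : H)) ∈ T → A z = 0 := by
    intro z hz
    have h1 := hTmono _ (hJ z) _ hz
    have h2 := hM (z - J z)
    have e : ⟪J z - z, γ⁻¹ • (M z - M (J z)) - 0⟫ = -(γ⁻¹ * ⟪M (z - J z), z - J z⟫) := by
      rw [sub_zero, ← map_sub, inner_smul_right, real_inner_comm, ← neg_sub z (J z),
        inner_neg_right]
      ring
    simp only at h1
    rw [e] at h1
    have h4 := mul_le_mul_of_nonneg_left h2 hγ'.le
    have h5 : γ⁻¹ * c * ‖z - J z‖ ^ 2 ≤ 0 := by linarith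
    have h6 : ‖z - J z‖ ^ 2 ≤ 0 := nonpos_of_mul_nonpos_right h5 (by positivity)
    have h7 : z - J z = 0 := by
      rw [← norm_eq_zero]
      exact pow_eq_zero_iff (two_ne_zero) |>.1 (le_antisymm h6 (sq_nonneg _))
    rw [hAM, h7]; simp
  have hanti : ∀ z, (z, (0 : H)) ∈ T → AntitoneOn (fun t => ‖u t - z‖ ^ 2) (Set.Ici 0) := by
    intro z hz
    refine aux_contract A hA0 u (fun _ => z) hu (fun t _ => ?_)
    rw [hZ z hz, neg_zero]
    exact hasDerivAt_const t z
  have hAlim := aux_to_zero A hκ hA u hu z₀ (hZ z₀ hz₀)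
  have hdb : ∀ x, ‖x - J x‖ ≤ γ / c * ‖A x‖ := by
    intro x
    have h1 := hM (x - J x)
    have h2 := real_inner_le_norm (M (x - J x)) (x - J x)
    have h3 : ‖M (x - J x)‖ = γ * ‖A x‖ := by
      rw [hAM, norm_smul, Real.norm_of_nonneg hγ'.le]; field_simp
    rw [h3] at h2
    rcases (norm_nonneg (x - J x)).eq_or_lt with h | h
    · rw [← h]; positivity
    · rw [div_mul_eq_mul_div, le_div_iff₀ hc]
      nlinarith
  have hdlim : Tendsto (fun t => u t - J (u t)) atTop (nhds 0) := by
    refine squeeze_zero_norm (fun t => hdb (u t)) ?_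
    simpa using hAlim.const_mul (γ / c)
  have hAlim' : Tendsto (fun t => A (u t)) atTop (nhds 0) := tendsto_zero_iff_norm_tendsto_zero.2 hAlim
  have hbd : ∀ t, 0 ≤ t → ‖u t‖ ≤ ‖u 0 - z₀‖ + ‖z₀‖ := by
    intro t ht
    have h1 := hanti z₀ hz₀ (Set.mem_Ici.2 le_rfl) (Set.mem_Ici.2 ht) ht
    have h2 := (sq_le_sq₀ (norm_nonneg _) (norm_nonneg _)).1 h1
    have h3 := norm_add_le (u t - z₀) z₀
    rw [sub_add_cancel] at h3
    linarith
  -- weak cluster points are zeros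
  have hclus : ∀ U : Ultrafilter ℝ, (U : Filter ℝ) ≤ atTop → ∃ x : H, (x, (0 : H)) ∈ T ∧
      ∀ w : H, Tendsto (fun t => ⟪u t, w⟫) U (nhds ⟪x, w⟫) := by
    intro U hU
    obtain ⟨x, hx⟩ := aux_weak u _ hbd U hU
    refine ⟨x, hTmax _ ?_, hx⟩
    intro q hq
    -- inner (J u - q1) (A u - q2)
    have hbdd : Tendsto (fun t => ⟪u t - q.1, A (u t)⟫) atTop (nhds 0) := by
      refine squeeze_zero_norm' (a := fun t => (‖u 0 - z₀‖ + ‖z₀‖ + ‖q.1‖) * ‖A (u t)‖) ?_ ?_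
      · filter_upwards [eventually_ge_atTop 0] with t ht
        refine (norm_inner_le_norm _ _).trans ?_
        gcongr
        exact (norm_sub_le _ _).trans (by linarith [hbd t ht])
      · simpa using hAlim.const_mul (‖u 0 - z₀‖ + ‖z₀‖ + ‖q.1‖)
    have hd2 : Tendsto (fun t => ⟪u t - J (u t), A (u t) - q.2⟫) atTop (nhds 0) := by
      have := hdlim.inner (𝕜 := ℝ) (hAlim'.sub_const q.2)
      simpa using this
    have hlim : Tendsto (fun t => ⟪u t - q.1, A (u t)⟫ - (⟪u t, q.2⟫ - ⟪q.1, q.2⟫)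
        - ⟪u t - J (u t), A (u t) - q.2⟫) U (nhds (0 - (⟪x, q.2⟫ - ⟪q.1, q.2⟫) - 0)) :=
      ((hbdd.mono_left hU).sub ((hx q.2).sub_const _)).sub (hd2.mono_left hU)
    have hnn : 0 ≤ 0 - (⟪x, q.2⟫ - ⟪q.1, q.2⟫) - 0 := by
      refine ge_of_tendsto' hlim (fun t => ?_)
      have h1 : 0 ≤ ⟪J (u t) - q.1, A (u t) - q.2⟫ := hTmono _ (hJ (u t)) _ hq
      have e : ⟪J (u t) - q.1, A (u t) - q.2⟫ = ⟪u t - q.1, A (u t)⟫ - (⟪u t, q.2⟫ - ⟪q.1, q.2⟫)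
        - ⟪u t - J (u t), A (u t) - q.2⟫ := by
        simp only [inner_sub_left, inner_sub_right]; ring
      rw [← e]; exact h1
    simp only [zero_sub, inner_neg_right, inner_sub_left]
    linarith
  obtain ⟨us, husT, hus⟩ := hclus (Ultrafilter.of atTop) (Ultrafilter.of_le _)
  refine ⟨us, husT, fun w => ?_⟩
  rw [tendsto_iff_ultrafilter]
  intro U hU
  obtain ⟨x, hxT, hx⟩ := hclus U hU
  have hxu : x = us := by
    obtain ⟨L1, hL1⟩ := aux_conv _ (hanti x hxT) (fun t => sq_nonneg _)
    obtain ⟨L2, hL2⟩ := aux_conv _ (hanti us husT) (fun t => sq_nonneg _)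
    have hL : Tendsto (fun t => ⟪u t, x - us⟫) atTop
        (nhds ((L2 - L1 + ‖x‖ ^ 2 - ‖us‖ ^ 2) / 2)) := by
      refine ((((hL2.sub hL1).add_const (‖x‖ ^ 2)).sub_const (‖us‖ ^ 2)).div_const 2).congr ?_
      intro t
      rw [norm_sub_sq_real, norm_sub_sq_real, inner_sub_right]
      ring
    have e1 := tendsto_nhds_unique (hx (x - us)) (hL.mono_left hU)
    have e2 := tendsto_nhds_unique (hus (x - us)) (hL.mono_left (Ultrafilter.of_le _))
    have e3 : ⟪x - us, x - us⟫ = 0 := by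
      rw [inner_sub_left, e1, e2, sub_self]
    exact sub_eq_zero.1 (inner_self_eq_zero.1 e3)
  rw [← hxu]
  exact hx w
end

section
/- Let A and B be maximally monotone set-valued operators on H such that the warped resolvents J_{λA}^M and J_{λB}^M exist for every λ > 0. Let (λ_n) be a sequence in (0,∞) with λ_n → 0, and for each n let x_n ∈ H satisfy 0 ∈ A_{λ_n}^M x_n + B x_n, i.e. (x_n, −A_{λ_n}^M x_n) ∈ G(B); set y_n = A_{λ_n}^M x_n. If the sequence (y_n) is bounded and x ∈ H is a strong limit point of (x_n) (i.e. some subsequence of (x_n) converges in norm to x), then x solves the inclusion 0 ∈ A x + B x, i.e. there exists y ∈ H with (x, y) ∈ G(A) and (x, −y) ∈ G(B). -/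
open scoped RealInnerProductSpace
open Filter

/-- A maximally monotone graph is closed under strong-weak limits of bounded families. -/
theorem aux_closed {H : Type*} [NormedAddCommGroup H] [InnerProductSpace ℝ H]
    (T : Set (H × H)) (U : Filter ℕ) [U.NeBot]
    (hmono : ∀ p ∈ T, ∀ q ∈ T, (0 : ℝ) ≤ ⟪p.1 - q.1, p.2 - q.2⟫)
    (hmax : ∀ p : H × H, (∀ q ∈ T, (0 : ℝ) ≤ ⟪p.1 - q.1, p.2 - q.2⟫) → p ∈ T)
    (u v : ℕ → H) (C : ℝ) (hv : ∀ n, ‖v n‖ ≤ C) (huv : ∀ n, (u n, v n) ∈ T)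
    (a b : H) (hu : Tendsto u U (nhds a))
    (hw : ∀ z : H, Tendsto (fun n => ⟪z, v n⟫) U (nhds ⟪z, b⟫)) : (a, b) ∈ T := by
  apply hmax
  intro q hq
  have h0 : Tendsto (fun n => ⟪u n - a, v n⟫) U (nhds 0) := by
    have h1 : Tendsto (fun n => ‖u n - a‖ * C) U (nhds 0) := by
      simpa using (tendsto_iff_norm_sub_tendsto_zero.1 hu).mul_const C
    refine squeeze_zero_norm (fun n => ?_) h1
    exact (norm_inner_le_norm _ _).trans
      (mul_le_mul_of_nonneg_left (hv n) (norm_nonneg _))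
  have h2 : Tendsto (fun n => ⟪u n - q.1, q.2⟫) U (nhds ⟪a - q.1, q.2⟫) :=
    (hu.sub_const q.1).inner tendsto_const_nhds
  have h3 := (h0.add (hw (a - q.1))).sub h2
  have h4 : (0 : ℝ) ≤ 0 + ⟪a - q.1, b⟫ - ⟪a - q.1, q.2⟫ := by
    refine ge_of_tendsto' h3 (fun n => ?_)
    have := hmono _ (huv n) q hq
    simp only [inner_sub_left, inner_sub_right] at this ⊢
    linarith
  simp only [inner_sub_right]
  linarith

/-- Weak compactness of balls, along an ultrafilter. -/
theorem aux_weak_s11 {H : Type*} [NormedAddCommGroup H] [InnerProductSpace ℝ H] [CompleteSpace H]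
    (U : Ultrafilter ℕ) (v : ℕ → H) (C : ℝ) (hv : ∀ n, ‖v n‖ ≤ C) :
    ∃ b : H, ∀ z : H, Tendsto (fun n => ⟪z, v n⟫) U (nhds ⟪z, b⟫) := by
  have hK := WeakDual.isCompact_closedBall (𝕜 := ℝ) (E := H) 0 C
  let f : ℕ → WeakDual ℝ H :=
    fun n => StrongDual.toWeakDual (InnerProductSpace.toDual ℝ H (v n))
  have hf : ∀ n, f n ∈ WeakDual.toStrongDual ⁻¹' Metric.closedBall (0 : StrongDual ℝ H) C := by
    intro n
    rw [Set.mem_preimage, mem_closedBall_zero_iff]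
    change ‖InnerProductSpace.toDual ℝ H (v n)‖ ≤ C
    simpa using hv n
  obtain ⟨g, -, hg⟩ := hK.ultrafilter_le_nhds (U.map f) (by
    rw [le_principal_iff]
    exact Filter.mem_map.2 (Filter.univ_mem' hf))
  have hg' : Tendsto f U (nhds g) := hg
  refine ⟨(InnerProductSpace.toDual ℝ H).symm (WeakDual.toStrongDual g), fun z => ?_⟩
  have h1 := ((WeakDual.eval_continuous z).tendsto g).comp hg'
  rw [real_inner_comm, InnerProductSpace.toDual_symm_apply]
  refine h1.congr (fun n => ?_)
  change InnerProductSpace.toDual ℝ H (v n) z = _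
  rw [InnerProductSpace.toDual_apply_apply, real_inner_comm]

/-- Let `A, B` be maximally monotone with warped resolvents `JA l`, `JB l`
for every `l > 0`. Let `λ_n → 0⁺`, and for each `n` let `x_n` solve
`0 ∈ A_{λ_n}^M x_n + B x_n`, with `y_n = A_{λ_n}^M x_n`. If `(y_n)` is bounded and some
subsequence of `(x_n)` converges in norm to `x`, then `x` solves `0 ∈ A x + B x`. -/
theorem stmt_11
    {H : Type*} [NormedAddCommGroup H] [InnerProductSpace ℝ H] [CompleteSpace H]
    (M : H →L[ℝ] H) (hMsa : IsSelfAdjoint M)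
    {c : ℝ} (hc : 0 < c) (hM : ∀ z : H, c * ‖z‖ ^ 2 ≤ ⟪M z, z⟫)
    (A B : Set (H × H))
    (hAmono : ∀ p ∈ A, ∀ q ∈ A, (0 : ℝ) ≤ ⟪p.1 - q.1, p.2 - q.2⟫)
    (hAmax : ∀ p : H × H, (∀ q ∈ A, (0 : ℝ) ≤ ⟪p.1 - q.1, p.2 - q.2⟫) → p ∈ A)
    (hBmono : ∀ p ∈ B, ∀ q ∈ B, (0 : ℝ) ≤ ⟪p.1 - q.1, p.2 - q.2⟫)
    (hBmax : ∀ p : H × H, (∀ q ∈ B, (0 : ℝ) ≤ ⟪p.1 - q.1, p.2 - q.2⟫) → p ∈ B)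
    (JA : ℝ → H → H)
    (hJA : ∀ l : ℝ, 0 < l → ∀ x : H, (JA l x, l⁻¹ • (M x - M (JA l x))) ∈ A)
    (JB : ℝ → H → H)
    (hJB : ∀ l : ℝ, 0 < l → ∀ x : H, (JB l x, l⁻¹ • (M x - M (JB l x))) ∈ B)
    (lam : ℕ → ℝ) (hlampos : ∀ n, 0 < lam n) (hlam0 : Tendsto lam atTop (nhds 0))
    (x : ℕ → H)
    (hx : ∀ n, (x n, -((lam n)⁻¹ • (M (x n) - M (JA (lam n) (x n))))) ∈ B)
    (hybdd : ∃ C : ℝ, ∀ n, ‖(lam n)⁻¹ • (M (x n) - M (JA (lam n) (x n)))‖ ≤ C)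
    (xx : H) (φ : ℕ → ℕ) (hφ : StrictMono φ)
    (hconv : Tendsto (fun n => x (φ n)) atTop (nhds xx)) :
    ∃ y : H, (xx, y) ∈ A ∧ (xx, -y) ∈ B := by
  obtain ⟨C, hC⟩ := hybdd
  let U : Ultrafilter ℕ := Filter.hyperfilter ℕ
  have hU : (U : Filter ℕ) ≤ atTop := by
    rw [← Nat.cofinite_eq_atTop]; exact Filter.hyperfilter_le_cofinite
  set y : ℕ → H := fun n => (lam n)⁻¹ • (M (x n) - M (JA (lam n) (x n))) with hy
  obtain ⟨b, hb⟩ := aux_weak_s11 U (fun n => y (φ n)) C (fun n => hC _)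
  have hdist : ∀ n, ‖JA (lam n) (x n) - x n‖ ≤ lam n * C / c := by
    intro n
    have hl := hlampos n
    have e : M (x n - JA (lam n) (x n)) = lam n • y n := by
      simp only [hy, map_sub]
      rw [smul_inv_smul₀ hl.ne']
    have h1 := hM (x n - JA (lam n) (x n))
    rw [e, real_inner_smul_left] at h1
    have h2 := real_inner_le_norm (y n) (x n - JA (lam n) (x n))
    have h3 := mul_le_mul_of_nonneg_right (hC n) (norm_nonneg (x n - JA (lam n) (x n)))
    have h4 := mul_le_mul_of_nonneg_left (h2.trans h3) hl.le
    have hC0 : 0 ≤ C := (norm_nonneg _).trans (hC n)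
    rw [norm_sub_rev, le_div_iff₀ hc]
    rcases (norm_nonneg (x n - JA (lam n) (x n))).eq_or_lt with h | h
    · rw [← h]; simp only [zero_mul]; positivity
    · refine le_of_mul_le_mul_right ?_ h
      nlinarith
  have hφt := hφ.tendsto_atTop
  have hu : Tendsto (fun n => JA (lam (φ n)) (x (φ n))) atTop (nhds xx) := by
    have h1 : Tendsto (fun n => lam (φ n) * C / c) atTop (nhds 0) := by
      simpa using ((hlam0.comp hφt).mul_const C).div_const c
    have h2 := squeeze_zero_norm (fun n => hdist (φ n)) h1
    simpa using h2.add hconv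
  refine ⟨b, ?_, ?_⟩
  · exact aux_closed A U hAmono hAmax _ _ C (fun n => hC (φ n))
      (fun n => hJA _ (hlampos _) _) xx b (hu.mono_left hU) hb
  · refine aux_closed B U hBmono hBmax (fun n => x (φ n)) (fun n => -y (φ n)) C
      (fun n => by rw [norm_neg]; exact hC (φ n))
      (fun n => hx _) xx (-b) (hconv.mono_left hU) (fun z => ?_)
    simpa only [inner_neg_right] using (hb z).neg
end

section
/- Let A and B be maximally monotone set-valued operators on H, let λ > 0, and suppose the warped resolvents J_{λA}^M and J_{λB}^M exist. Define E = {x ∈ H : (x, −A_λ^M x) ∈ G(B)} (the solutions of 0 ∈ A_λ^M x + B x) and F = {y ∈ H : (y, −B_λ^M y) ∈ G(A)} (the solutions of 0 ∈ A y + B_λ^M y). Then E = Fix(J_{λB}^M ∘ J_{λA}^M), F = Fix(J_{λA}^M ∘ J_{λB}^M), E = J_{λB}^M(F) (the image of F under J_{λB}^M), and F = J_{λA}^M(E). -/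
open scoped RealInnerProductSpace


theorem warped_unique {H : Type*} [NormedAddCommGroup H] [InnerProductSpace ℝ H]
    (M : H →L[ℝ] H) {c : ℝ} (hc : 0 < c) (hM : ∀ z : H, c * ‖z‖ ^ 2 ≤ ⟪M z, z⟫)
    (T : Set (H × H))
    (hT : ∀ p ∈ T, ∀ q ∈ T, (0 : ℝ) ≤ ⟪p.1 - q.1, p.2 - q.2⟫)
    {lam : ℝ} (hlam : 0 < lam)
    (J : H → H) (hJ : ∀ x : H, (J x, lam⁻¹ • (M x - M (J x))) ∈ T) (x y : H) :
    J x = y ↔ (y, -(lam⁻¹ • (M y - M x))) ∈ T := by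
  have e : -(lam⁻¹ • (M y - M x)) = lam⁻¹ • (M x - M y) := by
    rw [← smul_neg, neg_sub]
  rw [e]
  constructor
  · rintro rfl
    exact hJ x
  · intro h
    have h1 := hT _ h _ (hJ x)
    have e2 : lam⁻¹ • (M x - M y) - lam⁻¹ • (M x - M (J x)) = -(lam⁻¹ • M (y - J x)) := by
      rw [← smul_sub, map_sub, ← smul_neg]
      congr 1
      abel
    simp only [e2, inner_neg_right, inner_smul_right] at h1
    rw [real_inner_comm] at h1
    have h2 := hM (y - J x)
    have h3 : ⟪M (y - J x), y - J x⟫ ≤ 0 := by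
      by_contra! h4
      have := mul_pos (inv_pos.2 hlam) h4
      linarith
    have h5 : ‖y - J x‖ ^ 2 ≤ 0 := by
      by_contra! h6
      have := mul_pos hc h6
      linarith
    have h7 : ‖y - J x‖ = 0 := by nlinarith [norm_nonneg (y - J x)]
    exact (sub_eq_zero.1 (norm_eq_zero.1 h7)).symm

/-- Let `A, B` be maximally monotone, `λ > 0`, `JA = J_{λA}^M`,
`JB = J_{λB}^M`. With `E = {x : (x, −A_λ^M x) ∈ G(B)}` and `F = {y : (y, −B_λ^M y) ∈ G(A)}`,
we have `E = Fix(JB ∘ JA)`, `F = Fix(JA ∘ JB)`, `E = JB(F)` and `F = JA(E)`. -/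
theorem stmt_12
    {H : Type*} [NormedAddCommGroup H] [InnerProductSpace ℝ H] [CompleteSpace H]
    (M : H →L[ℝ] H) (hMsa : IsSelfAdjoint M)
    {c : ℝ} (hc : 0 < c) (hM : ∀ z : H, c * ‖z‖ ^ 2 ≤ ⟪M z, z⟫)
    (A B : Set (H × H))
    (hAmono : ∀ p ∈ A, ∀ q ∈ A, (0 : ℝ) ≤ ⟪p.1 - q.1, p.2 - q.2⟫)
    (hAmax : ∀ p : H × H, (∀ q ∈ A, (0 : ℝ) ≤ ⟪p.1 - q.1, p.2 - q.2⟫) → p ∈ A)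
    (hBmono : ∀ p ∈ B, ∀ q ∈ B, (0 : ℝ) ≤ ⟪p.1 - q.1, p.2 - q.2⟫)
    (hBmax : ∀ p : H × H, (∀ q ∈ B, (0 : ℝ) ≤ ⟪p.1 - q.1, p.2 - q.2⟫) → p ∈ B)
    {lam : ℝ} (hlam : 0 < lam)
    (JA : H → H) (hJA : ∀ x : H, (JA x, lam⁻¹ • (M x - M (JA x))) ∈ A)
    (JB : H → H) (hJB : ∀ x : H, (JB x, lam⁻¹ • (M x - M (JB x))) ∈ B)
    (E F : Set H)
    (hE : E = {x : H | (x, -(lam⁻¹ • (M x - M (JA x)))) ∈ B})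
    (hF : F = {y : H | (y, -(lam⁻¹ • (M y - M (JB y)))) ∈ A}) :
    E = {x : H | JB (JA x) = x} ∧ F = {y : H | JA (JB y) = y} ∧
      E = JB '' F ∧ F = JA '' E := by
  have hE' : E = {x : H | JB (JA x) = x} := by
    rw [hE]
    ext x
    exact (warped_unique M hc hM B hBmono hlam JB hJB (JA x) x).symm
  have hF' : F = {y : H | JA (JB y) = y} := by
    rw [hF]
    ext y
    exact (warped_unique M hc hM A hAmono hlam JA hJA (JB y) y).symm
  refine ⟨hE', hF', ?_, ?_⟩
  · rw [hE', hF']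
    ext x
    constructor
    · intro h
      exact ⟨JA x, congrArg JA h, h⟩
    · rintro ⟨y, h, rfl⟩
      exact congrArg JB h
  · rw [hE', hF']
    ext x
    constructor
    · intro h
      exact ⟨JB x, congrArg JB h, h⟩
    · rintro ⟨y, h, rfl⟩
      exact congrArg JA h
end

section
/- Let A and B be maximally monotone set-valued operators on H, let λ > 0, and suppose the warped resolvents J_{λA}^M and J_{λB}^M exist. Let E = {x ∈ H : (x, −A_λ^M x) ∈ G(B)} and F = {y ∈ H : (y, −B_λ^M y) ∈ G(A)}. Then the restriction of J_{λB}^M to F is a bijection from F onto E whose inverse is the restriction of J_{λA}^M to E; moreover the vector J_{λB}^M x − x is the same for every x ∈ F (so J_{λB}^M acts on F as a translation). -/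
open scoped RealInnerProductSpace

/-- Let `A, B` be maximally monotone, `λ > 0`, `JA = J_{λA}^M`,
`JB = J_{λB}^M`, `E = {x : (x, −A_λ^M x) ∈ G(B)}`, `F = {y : (y, −B_λ^M y) ∈ G(A)}`.
Then `JB` restricted to `F` is a bijection from `F` onto `E` with inverse the
restriction of `JA` to `E`, and `JB x − x` is constant on `F`. -/
theorem stmt_14
    {H : Type*} [NormedAddCommGroup H] [InnerProductSpace ℝ H] [CompleteSpace H]
    (M : H →L[ℝ] H) (hMsa : IsSelfAdjoint M)
    {c : ℝ} (hc : 0 < c) (hM : ∀ z : H, c * ‖z‖ ^ 2 ≤ ⟪M z, z⟫)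
    (A B : Set (H × H))
    (hAmono : ∀ p ∈ A, ∀ q ∈ A, (0 : ℝ) ≤ ⟪p.1 - q.1, p.2 - q.2⟫)
    (hAmax : ∀ p : H × H, (∀ q ∈ A, (0 : ℝ) ≤ ⟪p.1 - q.1, p.2 - q.2⟫) → p ∈ A)
    (hBmono : ∀ p ∈ B, ∀ q ∈ B, (0 : ℝ) ≤ ⟪p.1 - q.1, p.2 - q.2⟫)
    (hBmax : ∀ p : H × H, (∀ q ∈ B, (0 : ℝ) ≤ ⟪p.1 - q.1, p.2 - q.2⟫) → p ∈ B)
    {lam : ℝ} (hlam : 0 < lam)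
    (JA : H → H) (hJA : ∀ x : H, (JA x, lam⁻¹ • (M x - M (JA x))) ∈ A)
    (JB : H → H) (hJB : ∀ x : H, (JB x, lam⁻¹ • (M x - M (JB x))) ∈ B)
    (E F : Set H)
    (hE : E = {x : H | (x, -(lam⁻¹ • (M x - M (JA x)))) ∈ B})
    (hF : F = {y : H | (y, -(lam⁻¹ • (M y - M (JB y)))) ∈ A}) :
    Set.BijOn JB F E ∧
      (∀ x ∈ F, JA (JB x) = x) ∧ (∀ y ∈ E, JB (JA y) = y) ∧
      (∀ x₁ ∈ F, ∀ x₂ ∈ F, JB x₁ - x₁ = JB x₂ - x₂) := by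
  have hz : ∀ d : H, (0 : ℝ) ≤ - (lam⁻¹ * ⟪M d, d⟫) → d = 0 := by
    intro d hd
    have hl : 0 < lam⁻¹ := inv_pos.mpr hlam
    have h1 : ⟪M d, d⟫ ≤ 0 := by
      by_contra h
      have := mul_pos hl (not_le.mp h)
      linarith
    have h2 := hM d
    have h3 : ‖d‖ ^ 2 ≤ 0 := by
      by_contra h
      have := mul_pos hc (not_le.mp h)
      linarith
    have h4 : ‖d‖ = 0 := by
      have := sq_nonneg ‖d‖
      exact pow_eq_zero_iff (two_ne_zero) |>.mp (le_antisymm h3 this)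
    exact norm_eq_zero.mp h4
  have huniq : ∀ T : Set (H × H),
      (∀ p ∈ T, ∀ q ∈ T, (0 : ℝ) ≤ ⟪p.1 - q.1, p.2 - q.2⟫) →
      ∀ x p q : H, (p, lam⁻¹ • (M x - M p)) ∈ T → (q, lam⁻¹ • (M x - M q)) ∈ T → p = q := by
    intro T hT x p q hp hq
    have h := hT _ hp _ hq
    have e : lam⁻¹ • (M x - M p) - lam⁻¹ • (M x - M q) = -(lam⁻¹ • M (p - q)) := by
      rw [map_sub]; module
    simp only [e, inner_neg_right, real_inner_smul_right] at h
    rw [real_inner_comm] at h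
    exact sub_eq_zero.mp (hz _ h)
  have hneg : ∀ a b : H, -(lam⁻¹ • (a - b)) = lam⁻¹ • (b - a) := by
    intro a b; module
  simp only [hneg] at hE hF
  have hAB : ∀ x ∈ F, JA (JB x) = x := by
    intro x hx
    rw [hF] at hx
    exact huniq A hAmono (JB x) _ _ (hJA _) hx
  have hBA : ∀ y ∈ E, JB (JA y) = y := by
    intro y hy
    rw [hE] at hy
    exact huniq B hBmono (JA y) _ _ (hJB _) hy
  have hFE : ∀ x ∈ F, JB x ∈ E := by
    intro x hx
    have h := hJB x
    rw [hE, Set.mem_setOf_eq, hAB x hx]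
    exact h
  have hEF : ∀ y ∈ E, JA y ∈ F := by
    intro y hy
    have h := hJA y
    rw [hF, Set.mem_setOf_eq, hBA y hy]
    exact h
  refine ⟨⟨hFE, ?_, ?_⟩, hAB, hBA, ?_⟩
  · intro x hx y hy h
    rw [← hAB x hx, ← hAB y hy, h]
  · intro y hy
    exact ⟨JA y, hEF y hy, hBA y hy⟩
  · intro x₁ h₁ x₂ h₂
    rw [hF] at h₁ h₂
    have a := hAmono _ h₁ _ h₂
    have b := hBmono _ (hJB x₁) _ (hJB x₂)
    rw [← sub_eq_zero]
    apply hz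
    have e1 : lam⁻¹ • (M (JB x₁) - M x₁) - lam⁻¹ • (M (JB x₂) - M x₂)
        = lam⁻¹ • M (JB x₁ - x₁ - (JB x₂ - x₂)) := by
      simp only [map_sub]; module
    have e2 : lam⁻¹ • (M x₁ - M (JB x₁)) - lam⁻¹ • (M x₂ - M (JB x₂))
        = -(lam⁻¹ • M (JB x₁ - x₁ - (JB x₂ - x₂))) := by
      simp only [map_sub]; module
    simp only [e1, e2, inner_neg_right, real_inner_smul_right] at a b
    have e3 : JB x₁ - x₁ - (JB x₂ - x₂) = (JB x₁ - JB x₂) - (x₁ - x₂) := by abel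
    generalize hd : M (JB x₁ - x₁ - (JB x₂ - x₂)) = m at *
    rw [e3, real_inner_comm, inner_sub_left]
    linarith
end

section
/- Let A and B be maximally monotone set-valued operators on H, let λ > 0, and suppose the warped resolvents J_{λA}^M and J_{λB}^M exist. Let S = {(x,y) ∈ H × H : M y − M x ∈ λ A x and M x − M y ∈ λ B y} and assume S ≠ ∅. Fix x₀ ∈ H and define recursively y_n = J_{λB}^M x_n and x_{n+1} = J_{λA}^M y_n for n ≥ 0. Then for every (x̄, ȳ) ∈ S, the series Σ_{n∈ℕ} ‖(x_n − y_n) − (x̄ − ȳ)‖_M² and Σ_{n∈ℕ} ‖(x_{n+1} − y_n) − (x̄ − ȳ)‖_M² are both finite (indeed their sum is at most ‖x₀ − x̄‖_M²). -/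
open scoped RealInnerProductSpace

theorem stmt_15_step
    {H : Type*} [NormedAddCommGroup H] [InnerProductSpace ℝ H] [CompleteSpace H]
    (M : H →L[ℝ] H) (hMsa : IsSelfAdjoint M) {lam : ℝ} (hlam : 0 < lam) (a b p q : H)
    (h : (0 : ℝ) ≤ ⟪a - b, lam⁻¹ • (M p - M a) - lam⁻¹ • (M q - M b)⟫) :
    ⟪a - b, M (a - b)⟫ + ⟪(p - a) - (q - b), M ((p - a) - (q - b))⟫ ≤ ⟪p - q, M (p - q)⟫ := by
  rw [← smul_sub, inner_smul_right] at h
  have h1 := nonneg_of_mul_nonneg_right h (inv_pos.mpr hlam)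
  obtain ⟨u, hu⟩ : ∃ u, u = p - q := ⟨_, rfl⟩
  obtain ⟨v, hv⟩ : ∃ v, v = a - b := ⟨_, rfl⟩
  have e1 : (p - a) - (q - b) = u - v := by rw [hu, hv]; abel
  have e2 : M p - M a - (M q - M b) = M u - M v := by
    rw [hu, hv, map_sub, map_sub]; abel
  rw [e2, ← hv, inner_sub_right] at h1
  rw [e1, ← hv, ← hu, map_sub, inner_sub_left, inner_sub_right, inner_sub_right]
  have hs : ⟪u, M v⟫ = ⟪v, M u⟫ := by
    have := hMsa.isSymmetric u v
    rw [real_inner_comm (M u) v]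
    exact this.symm
  linarith

/-- Let `A, B` be maximally monotone, `λ > 0`, with warped resolvents
`JA = J_{λA}^M`, `JB = J_{λB}^M`, and let the solution set
`S = {(x,y) : My − Mx ∈ λAx and Mx − My ∈ λBy}` be nonempty. Given `x₀`, define
`y_n = JB x_n`, `x_{n+1} = JA y_n`. Then for every `(x̄,ȳ) ∈ S`, the series
`Σ ‖(x_n − y_n) − (x̄ − ȳ)‖_M²` and `Σ ‖(x_{n+1} − y_n) − (x̄ − ȳ)‖_M²` are finite, and
their sum is at most `‖x₀ − x̄‖_M²`. -/
theorem stmt_15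
    {H : Type*} [NormedAddCommGroup H] [InnerProductSpace ℝ H] [CompleteSpace H]
    (M : H →L[ℝ] H) (hMsa : IsSelfAdjoint M)
    {c : ℝ} (hc : 0 < c) (hM : ∀ z : H, c * ‖z‖ ^ 2 ≤ ⟪M z, z⟫)
    (A B : Set (H × H))
    (hAmono : ∀ p ∈ A, ∀ q ∈ A, (0 : ℝ) ≤ ⟪p.1 - q.1, p.2 - q.2⟫)
    (hAmax : ∀ p : H × H, (∀ q ∈ A, (0 : ℝ) ≤ ⟪p.1 - q.1, p.2 - q.2⟫) → p ∈ A)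
    (hBmono : ∀ p ∈ B, ∀ q ∈ B, (0 : ℝ) ≤ ⟪p.1 - q.1, p.2 - q.2⟫)
    (hBmax : ∀ p : H × H, (∀ q ∈ B, (0 : ℝ) ≤ ⟪p.1 - q.1, p.2 - q.2⟫) → p ∈ B)
    {lam : ℝ} (hlam : 0 < lam)
    (JA : H → H) (hJA : ∀ x : H, (JA x, lam⁻¹ • (M x - M (JA x))) ∈ A)
    (JB : H → H) (hJB : ∀ x : H, (JB x, lam⁻¹ • (M x - M (JB x))) ∈ B)
    (S : Set (H × H))
    (hS : S = {p : H × H |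
      (p.1, lam⁻¹ • (M p.2 - M p.1)) ∈ A ∧ (p.2, lam⁻¹ • (M p.1 - M p.2)) ∈ B})
    (hSne : S.Nonempty)
    (x y : ℕ → H) (hy : ∀ n, y n = JB (x n)) (hx : ∀ n, x (n + 1) = JA (y n)) :
    ∀ xb yb : H, (xb, yb) ∈ S →
      Summable (fun n : ℕ =>
        ⟪(x n - y n) - (xb - yb), M ((x n - y n) - (xb - yb))⟫) ∧
      Summable (fun n : ℕ =>
        ⟪(x (n + 1) - y n) - (xb - yb), M ((x (n + 1) - y n) - (xb - yb))⟫) ∧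
      (∑' n : ℕ,
        (⟪(x n - y n) - (xb - yb), M ((x n - y n) - (xb - yb))⟫ +
          ⟪(x (n + 1) - y n) - (xb - yb), M ((x (n + 1) - y n) - (xb - yb))⟫))
        ≤ ⟪x 0 - xb, M (x 0 - xb)⟫ := by
  intro xb yb hb
  rw [hS] at hb
  obtain ⟨hbA, hbB⟩ := hb
  have hQ : ∀ z : H, (0 : ℝ) ≤ ⟪z, M z⟫ := fun z => by
    rw [real_inner_comm]
    exact le_trans (by positivity) (hM z)
  set f : ℕ → ℝ := fun n => ⟪(x n - y n) - (xb - yb), M ((x n - y n) - (xb - yb))⟫ with hf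
  set g : ℕ → ℝ := fun n =>
    ⟪(x (n + 1) - y n) - (xb - yb), M ((x (n + 1) - y n) - (xb - yb))⟫ with hg
  have hf0 : ∀ n, 0 ≤ f n := fun n => hQ _
  have hg0 : ∀ n, 0 ≤ g n := fun n => hQ _
  have step : ∀ n, f n + g n + ⟪x (n + 1) - xb, M (x (n + 1) - xb)⟫
      ≤ ⟪x n - xb, M (x n - xb)⟫ := by
    intro n
    have h1 := stmt_15_step M hMsa hlam (y n) yb (x n) xb (by
      have := hBmono _ (hJB (x n)) _ hbB
      rw [← hy] at this
      exact this)
    have h2 := stmt_15_step M hMsa hlam (x (n + 1)) xb (y n) yb (by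
      have := hAmono _ (hJA (y n)) _ hbA
      rw [← hx] at this
      exact this)
    have e : (y n - x (n + 1)) - (yb - xb) = -((x (n + 1) - y n) - (xb - yb)) := by abel
    rw [e, map_neg, inner_neg_neg] at h2
    simp only [hf, hg]
    linarith
  have hsum : ∀ n, ∑ i ∈ Finset.range n, (f i + g i) + ⟪x n - xb, M (x n - xb)⟫
      ≤ ⟪x 0 - xb, M (x 0 - xb)⟫ := by
    intro n
    induction n with
    | zero => simp
    | succ k ih =>
      rw [Finset.sum_range_succ]
      linarith [step k]
  have hle : ∀ n, ∑ i ∈ Finset.range n, (f i + g i) ≤ ⟪x 0 - xb, M (x 0 - xb)⟫ := fun n => by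
    linarith [hsum n, hQ (x n - xb)]
  have h0 : ∀ n, 0 ≤ f n + g n := fun n => add_nonneg (hf0 n) (hg0 n)
  have hS1 : Summable (fun n => f n + g n) := summable_of_sum_range_le h0 hle
  refine ⟨hS1.of_nonneg_of_le hf0 fun n => by linarith [hg0 n],
    hS1.of_nonneg_of_le hg0 fun n => by linarith [hf0 n],
    Real.tsum_le_of_sum_range_le h0 hle⟩
end

section
/- Let A and B be maximally monotone set-valued operators on H, let λ > 0, and suppose the warped resolvents J_{λA}^M and J_{λB}^M exist. Let S = {(x,y) ∈ H × H : M y − M x ∈ λ A x and M x − M y ∈ λ B y} and assume S ≠ ∅. Fix x₀ ∈ H and define recursively y_n = J_{λB}^M x_n and x_{n+1} = J_{λA}^M y_n for n ≥ 0. Then for every (x̄, ȳ) ∈ S, the sequence y_n − x_n converges in norm to ȳ − x̄ and the sequence x_{n+1} − y_n converges in norm to x̄ − ȳ. (In particular the limits are the same for every choice of (x̄, ȳ) ∈ S, and x_{n+1} − x_n → 0 in norm.) -/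
open scoped RealInnerProductSpace
open Filter

theorem aux_17 {H : Type*} [NormedAddCommGroup H] [InnerProductSpace ℝ H] [CompleteSpace H]
    (M : H →L[ℝ] H) (hMsa : IsSelfAdjoint M) {lam : ℝ} (hlam : 0 < lam) (a b a' b' : H)
    (h : (0 : ℝ) ≤ ⟪b - b', lam⁻¹ • (M a - M b) - lam⁻¹ • (M a' - M b')⟫) :
    ⟪M (b - b'), b - b'⟫ + ⟪M ((a - a') - (b - b')), (a - a') - (b - b')⟫
      ≤ ⟪M (a - a'), a - a'⟫ := by
  have hs : ∀ u v : H, ⟪M u, v⟫ = ⟪u, M v⟫ := fun u v =>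
    (ContinuousLinearMap.isSelfAdjoint_iff_isSymmetric.mp hMsa) u v
  have e : lam⁻¹ • (M a - M b) - lam⁻¹ • (M a' - M b') = lam⁻¹ • (M (a - a') - M (b - b')) := by
    rw [← smul_sub]; congr 1; simp only [map_sub]; abel
  rw [e, inner_smul_right] at h
  have h2 : 0 ≤ ⟪b - b', M (a - a') - M (b - b')⟫ :=
    nonneg_of_mul_nonneg_right h (inv_pos.mpr hlam)
  generalize a - a' = u at *
  generalize b - b' = v at *
  rw [inner_sub_right] at h2
  rw [map_sub, inner_sub_left, inner_sub_right, inner_sub_right, hs u v, hs v u, hs v v]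
  have h3 : ⟪u, M v⟫ = ⟪v, M u⟫ := by rw [← hs, real_inner_comm]
  linarith

/-- Let `A, B` be maximally monotone, `λ > 0`, with warped resolvents
`JA = J_{λA}^M`, `JB = J_{λB}^M`, and let the solution set
`S = {(x,y) : My − Mx ∈ λAx and Mx − My ∈ λBy}` be nonempty. Given `x₀`, define
`y_n = JB x_n`, `x_{n+1} = JA y_n`. Then for every `(x̄,ȳ) ∈ S`, `y_n − x_n → ȳ − x̄`
and `x_{n+1} − y_n → x̄ − ȳ` in norm; in particular `x_{n+1} − x_n → 0`. -/
theorem stmt_17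
    {H : Type*} [NormedAddCommGroup H] [InnerProductSpace ℝ H] [CompleteSpace H]
    (M : H →L[ℝ] H) (hMsa : IsSelfAdjoint M)
    {c : ℝ} (hc : 0 < c) (hM : ∀ z : H, c * ‖z‖ ^ 2 ≤ ⟪M z, z⟫)
    (A B : Set (H × H))
    (hAmono : ∀ p ∈ A, ∀ q ∈ A, (0 : ℝ) ≤ ⟪p.1 - q.1, p.2 - q.2⟫)
    (hAmax : ∀ p : H × H, (∀ q ∈ A, (0 : ℝ) ≤ ⟪p.1 - q.1, p.2 - q.2⟫) → p ∈ A)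
    (hBmono : ∀ p ∈ B, ∀ q ∈ B, (0 : ℝ) ≤ ⟪p.1 - q.1, p.2 - q.2⟫)
    (hBmax : ∀ p : H × H, (∀ q ∈ B, (0 : ℝ) ≤ ⟪p.1 - q.1, p.2 - q.2⟫) → p ∈ B)
    {lam : ℝ} (hlam : 0 < lam)
    (JA : H → H) (hJA : ∀ x : H, (JA x, lam⁻¹ • (M x - M (JA x))) ∈ A)
    (JB : H → H) (hJB : ∀ x : H, (JB x, lam⁻¹ • (M x - M (JB x))) ∈ B)
    (S : Set (H × H))
    (hS : S = {p : H × H |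
      (p.1, lam⁻¹ • (M p.2 - M p.1)) ∈ A ∧ (p.2, lam⁻¹ • (M p.1 - M p.2)) ∈ B})
    (hSne : S.Nonempty)
    (x y : ℕ → H) (hy : ∀ n, y n = JB (x n)) (hx : ∀ n, x (n + 1) = JA (y n)) :
    ∀ xb yb : H, (xb, yb) ∈ S →
      Tendsto (fun n : ℕ => y n - x n) atTop (nhds (yb - xb)) ∧
      Tendsto (fun n : ℕ => x (n + 1) - y n) atTop (nhds (xb - yb)) ∧
      Tendsto (fun n : ℕ => x (n + 1) - x n) atTop (nhds 0) := by
  intro xb yb hp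
  rw [hS] at hp
  obtain ⟨hpA, hpB⟩ := hp
  have hq : ∀ z : H, 0 ≤ ⟪M z, z⟫ := fun z => le_trans (by positivity) (hM z)
  have h1 : ∀ n, ⟪M (y n - yb), y n - yb⟫
      + ⟪M ((x n - xb) - (y n - yb)), (x n - xb) - (y n - yb)⟫ ≤ ⟪M (x n - xb), x n - xb⟫ := by
    intro n
    apply aux_17 M hMsa hlam
    have := hBmono _ (hJB (x n)) _ hpB
    rw [← hy n] at this
    exact this
  have h2 : ∀ n, ⟪M (x (n + 1) - xb), x (n + 1) - xb⟫
      + ⟪M ((y n - yb) - (x (n + 1) - xb)), (y n - yb) - (x (n + 1) - xb)⟫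
        ≤ ⟪M (y n - yb), y n - yb⟫ := by
    intro n
    apply aux_17 M hMsa hlam
    have := hAmono _ (hJA (y n)) _ hpA
    rw [← hx n] at this
    exact this
  obtain ⟨l, hl⟩ : ∃ l, Tendsto (fun n => ⟪M (x n - xb), x n - xb⟫) atTop (nhds l) := by
    refine ⟨_, tendsto_atTop_ciInf (antitone_nat_of_succ_le fun n => ?_) ⟨0, ?_⟩⟩
    · linarith [h1 n, h2 n, hq ((x n - xb) - (y n - yb)), hq ((y n - yb) - (x (n + 1) - xb))]
    · rintro _ ⟨n, rfl⟩
      exact hq _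
  have hd : Tendsto (fun n => c⁻¹ * (⟪M (x n - xb), x n - xb⟫
      - ⟪M (x (n + 1) - xb), x (n + 1) - xb⟫)) atTop (nhds 0) := by
    have := (hl.sub (hl.comp (tendsto_add_atTop_nat 1))).const_mul c⁻¹
    simpa using this
  have key : ∀ z : ℕ → H, (∀ n, ⟪M (z n), z n⟫ ≤ ⟪M (x n - xb), x n - xb⟫
      - ⟪M (x (n + 1) - xb), x (n + 1) - xb⟫) → Tendsto z atTop (nhds 0) := by
    intro z hz
    have hsq : Tendsto (fun n => ‖z n‖ ^ 2) atTop (nhds 0) := by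
      refine squeeze_zero (fun n => by positivity) (fun n => ?_) hd
      rw [inv_mul_eq_div, le_div_iff₀ hc, mul_comm]
      exact (hM _).trans (hz n)
    rw [tendsto_zero_iff_norm_tendsto_zero]
    have := hsq.sqrt
    simpa using this
  have k1 := key (fun n => (x n - xb) - (y n - yb)) fun n => by
    linarith [h1 n, h2 n, hq ((y n - yb) - (x (n + 1) - xb))]
  have k2 := key (fun n => (y n - yb) - (x (n + 1) - xb)) fun n => by
    linarith [h1 n, h2 n, hq ((x n - xb) - (y n - yb))]
  have t1 : Tendsto (fun n : ℕ => y n - x n) atTop (nhds (yb - xb)) := by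
    have := k1.const_sub (yb - xb)
    rw [sub_zero] at this
    refine this.congr fun n => ?_
    abel
  have t2 : Tendsto (fun n : ℕ => x (n + 1) - y n) atTop (nhds (xb - yb)) := by
    have := k2.const_sub (xb - yb)
    rw [sub_zero] at this
    refine this.congr fun n => ?_
    abel
  refine ⟨t1, t2, ?_⟩
  have := t2.add t1
  simpa using this
end

section
/- Let f, g : H → (−∞, ∞] be proper, convex, lower semicontinuous functions and let λ > 0. For x ∈ H, let prox_{λf}^M x denote the unique minimizer over u ∈ H of f(u) + (1/(2λ))‖x − u‖_M² (which exists and is unique since M is strongly positive), and similarly prox_{λg}^M. Define Φ : H × H → (−∞, ∞] by Φ(x,y) = f(x) + g(y) + (1/(2λ))‖x − y‖_M², and let S = argmin Φ = {(x,y) : Φ(x,y) ≤ Φ(u,v) for all (u,v) ∈ H × H}; assume S ≠ ∅. Fix x₀ ∈ H and define recursively y_n = prox_{λg}^M x_n and x_{n+1} = prox_{λf}^M y_n for n ≥ 0. Then: (a) there exists (x̄, ȳ) ∈ S such that x_n converges weakly to x̄ and y_n converges weakly to ȳ; (b) for every (x̄, ȳ) ∈ S, Σ_{n∈ℕ} ‖(x_n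 − y_n) − (x̄ − ȳ)‖_M² < ∞ and Σ_{n∈ℕ} ‖(x_{n+1} − y_n) − (x̄ − ȳ)‖_M² < ∞; (c) for every (x̄, ȳ) ∈ S, y_n − x_n converges in norm to ȳ − x̄ and x_{n+1} − y_n converges in norm to x̄ − ȳ. -/
open scoped RealInnerProductSpace
open Filter

/-- The objective `u ↦ f(u) + (1/(2λ))‖x − u‖_M²` whose unique minimizer is
`prox_{λf}^M x`. -/
noncomputable def proxObj {H : Type*} [NormedAddCommGroup H] [InnerProductSpace ℝ H]
    (M : H →L[ℝ] H) (lam : ℝ) (f : H → EReal) (x u : H) : EReal :=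
  f u + (((2 * lam)⁻¹ * ⟪x - u, M (x - u)⟫ : ℝ) : EReal)

/-- The function `Φ(x,y) = f(x) + g(y) + (1/(2λ))‖x − y‖_M²`. -/
noncomputable def PhiFun {H : Type*} [NormedAddCommGroup H] [InnerProductSpace ℝ H]
    (M : H →L[ℝ] H) (lam : ℝ) (f g : H → EReal) (p : H × H) : EReal :=
  f p.1 + g p.2 + (((2 * lam)⁻¹ * ⟪p.1 - p.2, M (p.1 - p.2)⟫ : ℝ) : EReal)

section Aux19
variable {H : Type*} [NormedAddCommGroup H] [InnerProductSpace ℝ H]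

lemma aux_finite (M : H →L[ℝ] H) (lam : ℝ) (f : H → EReal)
    (hne : ∃ x, f x ≠ ⊤) (x p : H)
    (hp : ∀ u, proxObj M lam f x p ≤ proxObj M lam f x u) : f p ≠ ⊤ := by
  obtain ⟨u, hu⟩ := hne
  intro h
  have h1 := hp u
  unfold proxObj at h1
  rw [h, EReal.top_add_coe, top_le_iff] at h1
  exact EReal.add_ne_top hu (EReal.coe_ne_top _) h1

lemma aux_quad (M : H →L[ℝ] H) (hs : ∀ a b : H, ⟪a, M b⟫ = ⟪b, M a⟫) (a b : H) (t : ℝ) :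
    ⟪a - t • b, M (a - t • b)⟫ = ⟪a, M a⟫ - 2 * t * ⟪a, M b⟫ + t ^ 2 * ⟪b, M b⟫ := by
  simp only [map_sub, map_smul, inner_sub_left, inner_sub_right, real_inner_smul_left,
    real_inner_smul_right]
  rw [hs b a]; ring

lemma aux_vi (M : H →L[ℝ] H) (hs : ∀ a b : H, ⟪a, M b⟫ = ⟪b, M a⟫)
    {lam : ℝ} (hlam : 0 < lam) (f : H → EReal)
    (hne : ∃ x, f x ≠ ⊤) (hnbot : ∀ x, f x ≠ ⊥)
    (hconv : ∀ x y : H, ∀ a b : ℝ, 0 ≤ a → 0 ≤ b → a + b = 1 →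
      f (a • x + b • y) ≤ (a : EReal) * f x + (b : EReal) * f y)
    (x p : H) (hp : ∀ u, proxObj M lam f x p ≤ proxObj M lam f x u)
    (u : H) (hu : f u ≠ ⊤) :
    (f p).toReal + lam⁻¹ * ⟪x - p, M (u - p)⟫ ≤ (f u).toReal := by
  have hfp := aux_finite M lam f hne x p hp
  obtain ⟨α, hα⟩ : ∃ α : ℝ, f p = α := ⟨_, (EReal.coe_toReal hfp (hnbot p)).symm⟩
  obtain ⟨β, hβ⟩ : ∃ β : ℝ, f u = β := ⟨_, (EReal.coe_toReal hu (hnbot u)).symm⟩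
  rw [hα, hβ, EReal.toReal_coe, EReal.toReal_coe]
  set b := ⟪x - p, M (u - p)⟫
  set Q := ⟪u - p, M (u - p)⟫
  have key : ∀ t : ℝ, 0 < t → t ≤ 1 → α + lam⁻¹ * b ≤ β + t * ((2 * lam)⁻¹ * Q) := by
    intro t ht ht1
    have h1 := hp ((1 - t) • p + t • u)
    have h2 := hconv p u (1 - t) t (by linarith) ht.le (by ring)
    have h3 := h1.trans (add_le_add_left h2 _)
    unfold proxObj at h3
    have e : x - ((1 - t) • p + t • u) = (x - p) - t • (u - p) := by module
    rw [e, aux_quad M hs, hα, hβ] at h3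
    have h4 : α + (2 * lam)⁻¹ * ⟪x - p, M (x - p)⟫ ≤ (1 - t) * α + t * β +
      (2 * lam)⁻¹ * (⟪x - p, M (x - p)⟫ - 2 * t * b + t ^ 2 * Q) := by exact_mod_cast h3
    have h5 : t * (α + lam⁻¹ * b) ≤ t * (β + t * ((2 * lam)⁻¹ * Q)) := by
      rw [mul_inv] at *
      linarith
    exact le_of_mul_le_mul_left h5 ht
  have lim : Tendsto (fun t : ℝ => β + t * ((2 * lam)⁻¹ * Q)) (nhdsWithin 0 (Set.Ioi 0))
      (nhds (β + 0 * ((2 * lam)⁻¹ * Q))) := by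
    apply Tendsto.mono_left _ nhdsWithin_le_nhds
    exact Continuous.tendsto (by fun_prop) 0
  rw [zero_mul, add_zero] at lim
  refine ge_of_tendsto lim ?_
  filter_upwards [Ioc_mem_nhdsGT (zero_lt_one (α := ℝ))] with t ht
  exact key t ht.1 ht.2

lemma aux_firm (M : H →L[ℝ] H) (hs : ∀ a b : H, ⟪a, M b⟫ = ⟪b, M a⟫)
    {lam : ℝ} (hlam : 0 < lam) (f : H → EReal)
    (hne : ∃ x, f x ≠ ⊤) (hnbot : ∀ x, f x ≠ ⊥)
    (hconv : ∀ x y : H, ∀ a b : ℝ, 0 ≤ a → 0 ≤ b → a + b = 1 →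
      f (a • x + b • y) ≤ (a : EReal) * f x + (b : EReal) * f y)
    (x p : H) (hp : ∀ u, proxObj M lam f x p ≤ proxObj M lam f x u)
    (x' p' : H) (hp' : ∀ u, proxObj M lam f x' p' ≤ proxObj M lam f x' u) :
    0 ≤ ⟪M ((x - p) - (x' - p')), p - p'⟫ := by
  have h1 := aux_vi M hs hlam f hne hnbot hconv x p hp p' (aux_finite M lam f hne x' p' hp')
  have h2 := aux_vi M hs hlam f hne hnbot hconv x' p' hp' p (aux_finite M lam f hne x p hp)
  have h3 : 0 ≤ lam⁻¹ * (- ⟪x - p, M (p' - p)⟫ - ⟪x' - p', M (p - p')⟫) := by linarith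
  have h4 := nonneg_of_mul_nonneg_right h3 (inv_pos.mpr hlam)
  have e : p' - p = - (p - p') := by abel
  rw [real_inner_comm, hs, inner_sub_left]
  rw [e, map_neg, inner_neg_right] at h4
  linarith

lemma aux_ne (M : H →L[ℝ] H) (hs : ∀ a b : H, ⟪a, M b⟫ = ⟪b, M a⟫)
    (x p x' p' : H) (h : 0 ≤ ⟪M ((x - p) - (x' - p')), p - p'⟫) :
    ⟪p - p', M (p - p')⟫ + ⟪(x - p) - (x' - p'), M ((x - p) - (x' - p'))⟫
      ≤ ⟪x - x', M (x - x')⟫ := by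
  have e : x - x' = (p - p') - (-1 : ℝ) • ((x - p) - (x' - p')) := by module
  rw [e, aux_quad M hs]
  rw [real_inner_comm] at h
  linarith

lemma aux_strong_weak {F : Filter ℕ} (s r : ℕ → H) (s0 r0 : H) (C : ℝ)
    (hs : Tendsto s F (nhds s0)) (hr : ∀ w, Tendsto (fun n => ⟪r n, w⟫) F (nhds ⟪r0, w⟫))
    (hC : ∀ n, ‖r n‖ ≤ C) : Tendsto (fun n => ⟪s n, r n⟫) F (nhds ⟪s0, r0⟫) := by
  have h1 : Tendsto (fun n => ⟪s n - s0, r n⟫) F (nhds 0) := by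
    have h0 : Tendsto (fun n => ‖s n - s0‖ * C) F (nhds 0) := by
      simpa using (tendsto_iff_norm_sub_tendsto_zero.mp hs).mul_const C
    refine squeeze_zero_norm (fun n => ?_) h0
    exact (norm_inner_le_norm _ _).trans (mul_le_mul_of_nonneg_left (hC n) (norm_nonneg _))
  have h2 := h1.add (hr s0)
  refine (h2.congr fun n => ?_).trans (by rw [zero_add, real_inner_comm])
  rw [inner_sub_left, real_inner_comm s0]; ring

lemma aux_weak_compact [CompleteSpace H] (U : Ultrafilter ℕ) (r : ℕ → H) (C : ℝ)
    (hC : ∀ n, ‖r n‖ ≤ C) :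
    ∃ r0, ∀ w, Tendsto (fun n => ⟪r n, w⟫) U (nhds ⟪r0, w⟫) := by
  have hb : ∀ w n, |⟪r n, w⟫| ≤ C * ‖w‖ := fun w n =>
    (abs_real_inner_le_norm _ _).trans (mul_le_mul_of_nonneg_right (hC n) (norm_nonneg _))
  have h : ∀ w, ∃ l : ℝ, |l| ≤ C * ‖w‖ ∧ Tendsto (fun n => ⟪r n, w⟫) U (nhds l) := by
    intro w
    have hk : IsCompact (Set.Icc (-(C * ‖w‖)) (C * ‖w‖)) := isCompact_Icc
    obtain ⟨l, hl, hle⟩ := hk.ultrafilter_le_nhds (U.map fun n => ⟪r n, w⟫) (by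
      rw [le_principal_iff]
      exact Filter.mem_map.mpr (Filter.univ_mem' fun n => abs_le.mp (hb w n)))
    exact ⟨l, abs_le.mpr hl, hle⟩
  choose l hl hlt using h
  let L : H →ₗ[ℝ] ℝ :=
    { toFun := l
      map_add' := fun a b => tendsto_nhds_unique (hlt (a + b)) (by
        simpa only [inner_add_right] using (hlt a).add (hlt b))
      map_smul' := fun t a => tendsto_nhds_unique (hlt (t • a)) (by
        simpa only [real_inner_smul_right, RingHom.id_apply, smul_eq_mul] using (hlt a).const_mul t) }
  let L' : H →L[ℝ] ℝ := L.mkContinuous C hl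
  refine ⟨(InnerProductSpace.toDual ℝ H).symm L', fun w => ?_⟩
  rw [InnerProductSpace.toDual_symm_apply]
  exact hlt w

lemma aux_summable (a b : ℕ → ℝ) (ha : ∀ n, 0 ≤ a n) (hb : ∀ n, 0 ≤ b n)
    (h : ∀ n, a (n + 1) + b n ≤ a n) : Summable b := by
  refine summable_of_sum_range_le (c := a 0) hb fun n => ?_
  have : ∑ i ∈ Finset.range n, b i + a n ≤ a 0 := by
    induction n with
    | zero => simp
    | succ k ih => rw [Finset.sum_range_succ]; linarith [h k]
  linarith [ha n]

lemma aux_S_left (M : H →L[ℝ] H) (lam : ℝ) (f g : H → EReal)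
    (hfne : ∃ x, f x ≠ ⊤) (hgne : ∃ x, g x ≠ ⊤)
    (hf : ∀ x, f x ≠ ⊥) (hg : ∀ x, g x ≠ ⊥) (p : H × H)
    (hp : ∀ q : H × H, PhiFun M lam f g p ≤ PhiFun M lam f g q) :
    (∀ u, proxObj M lam f p.2 p.1 ≤ proxObj M lam f p.2 u) ∧
    (∀ u, proxObj M lam g p.1 p.2 ≤ proxObj M lam g p.1 u) := by
  obtain ⟨u, hu⟩ := hfne
  obtain ⟨v, hv⟩ := hgne
  have hfin : f p.1 ≠ ⊤ ∧ g p.2 ≠ ⊤ := by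
    have h := hp (u, v)
    unfold PhiFun at h
    have hlt := h.trans_lt (lt_top_iff_ne_top.mpr
      (EReal.add_ne_top (EReal.add_ne_top hu hv) (EReal.coe_ne_top _)))
    constructor
    · intro h0
      rw [h0, EReal.top_add_of_ne_bot (hg _), EReal.top_add_coe] at hlt
      exact lt_irrefl _ hlt
    · intro h0
      rw [h0, EReal.add_top_of_ne_bot (hf _), EReal.top_add_coe] at hlt
      exact lt_irrefl _ hlt
  obtain ⟨α, hα⟩ : ∃ α : ℝ, f p.1 = α := ⟨_, (EReal.coe_toReal hfin.1 (hf _)).symm⟩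
  obtain ⟨β, hβ⟩ : ∃ β : ℝ, g p.2 = β := ⟨_, (EReal.coe_toReal hfin.2 (hg _)).symm⟩
  have en : ∀ a b : H, ⟪a - b, M (a - b)⟫ = ⟪b - a, M (b - a)⟫ := by
    intro a b
    rw [← neg_sub b a, map_neg, inner_neg_neg]
  constructor
  · intro w
    unfold proxObj
    by_cases hw : f w = ⊤
    · rw [hw, EReal.top_add_coe]; exact le_top
    · have h := hp (w, p.2)
      unfold PhiFun at h
      obtain ⟨γ, hγ⟩ : ∃ γ : ℝ, f w = γ := ⟨_, (EReal.coe_toReal hw (hf _)).symm⟩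
      simp only [hα, hβ, hγ] at h ⊢
      norm_cast at h ⊢
      rw [en p.2 p.1, en p.2 w]
      linarith
  · intro w
    unfold proxObj
    by_cases hw : g w = ⊤
    · rw [hw, EReal.top_add_coe]; exact le_top
    · have h := hp (p.1, w)
      unfold PhiFun at h
      obtain ⟨γ, hγ⟩ : ∃ γ : ℝ, g w = γ := ⟨_, (EReal.coe_toReal hw (hg _)).symm⟩
      simp only [hα, hβ, hγ] at h ⊢
      norm_cast at h ⊢
      linarith

lemma aux_S_right (M : H →L[ℝ] H) (hs : ∀ a b : H, ⟪a, M b⟫ = ⟪b, M a⟫)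
    (hpos : ∀ a : H, 0 ≤ ⟪a, M a⟫)
    {lam : ℝ} (hlam : 0 < lam) (f g : H → EReal)
    (hfne : ∃ x, f x ≠ ⊤) (hfnbot : ∀ x, f x ≠ ⊥)
    (hgne : ∃ x, g x ≠ ⊤) (hgnbot : ∀ x, g x ≠ ⊥)
    (hfconv : ∀ x y : H, ∀ a b : ℝ, 0 ≤ a → 0 ≤ b → a + b = 1 →
      f (a • x + b • y) ≤ (a : EReal) * f x + (b : EReal) * f y)
    (hgconv : ∀ x y : H, ∀ a b : ℝ, 0 ≤ a → 0 ≤ b → a + b = 1 →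
      g (a • x + b • y) ≤ (a : EReal) * g x + (b : EReal) * g y)
    (x y : H) (hx : ∀ u, proxObj M lam f y x ≤ proxObj M lam f y u)
    (hy : ∀ u, proxObj M lam g x y ≤ proxObj M lam g x u) (q : H × H) :
    PhiFun M lam f g (x, y) ≤ PhiFun M lam f g q := by
  obtain ⟨u, v⟩ := q
  unfold PhiFun
  dsimp only
  by_cases hu : f u = ⊤
  · rw [hu, EReal.top_add_of_ne_bot (hgnbot _), EReal.top_add_coe]; exact le_top
  by_cases hv : g v = ⊤
  · rw [hv, EReal.add_top_of_ne_bot (hfnbot _), EReal.top_add_coe]; exact le_top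
  have h1 := aux_vi M hs hlam f hfne hfnbot hfconv y x hx u hu
  have h2 := aux_vi M hs hlam g hgne hgnbot hgconv x y hy v hv
  have h3 := hpos ((x - y) - (1 : ℝ) • (u - v))
  rw [aux_quad M hs] at h3
  have h4 : ⟪y - x, M (u - x)⟫ + ⟪x - y, M (v - y)⟫
      = ⟪x - y, M (x - y)⟫ - ⟪x - y, M (u - v)⟫ := by
    have e1 : y - x = -(x - y) := by abel
    rw [e1, inner_neg_left, ← inner_neg_right, ← map_neg, ← inner_add_right, ← map_add,
      ← inner_sub_right, ← map_sub]
    congr 2; abel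
  rw [← EReal.coe_toReal (aux_finite M lam f hfne y x hx) (hfnbot x),
    ← EReal.coe_toReal (aux_finite M lam g hgne x y hy) (hgnbot y),
    ← EReal.coe_toReal hu (hfnbot u), ← EReal.coe_toReal hv (hgnbot v)]
  norm_cast
  have h5 : (2 * lam)⁻¹ * 2 = lam⁻¹ := by rw [mul_inv]; ring
  have h6 : 0 ≤ (2 * lam)⁻¹ := by positivity
  have h7 := mul_nonneg h6 h3
  rw [← h5] at h1 h2
  have h8 := congrArg (fun z => (2 * lam)⁻¹ * 2 * z) h4
  nlinarith

end Aux19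

/-- Let `f, g : H → (−∞,∞]` be proper convex lower semicontinuous, `λ > 0`,
and let `prox_{λf}^M`, `prox_{λg}^M` be the (unique) `M`-proximal maps. Let
`S = argmin Φ ≠ ∅` where `Φ(x,y) = f(x) + g(y) + (1/(2λ))‖x−y‖_M²`. Given `x₀`, define
`y_n = prox_{λg}^M x_n`, `x_{n+1} = prox_{λf}^M y_n`. Then (a) `(x_n, y_n)` converges
weakly to some point of `S`; (b) for every `(x̄,ȳ) ∈ S` the series
`Σ ‖(x_n − y_n) − (x̄ − ȳ)‖_M²` and `Σ ‖(x_{n+1} − y_n) − (x̄ − ȳ)‖_M²` are finite;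
(c) for every `(x̄,ȳ) ∈ S`, `y_n − x_n → ȳ − x̄` and `x_{n+1} − y_n → x̄ − ȳ` in norm. -/
theorem stmt_19
    {H : Type*} [NormedAddCommGroup H] [InnerProductSpace ℝ H] [CompleteSpace H]
    (M : H →L[ℝ] H) (hMsa : IsSelfAdjoint M)
    {c : ℝ} (hc : 0 < c) (hM : ∀ z : H, c * ‖z‖ ^ 2 ≤ ⟪M z, z⟫)
    (f g : H → EReal)
    (hfne : ∃ x, f x ≠ ⊤) (hfnbot : ∀ x, f x ≠ ⊥)
    (hgne : ∃ x, g x ≠ ⊤) (hgnbot : ∀ x, g x ≠ ⊥)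
    (hfconv : ∀ x y : H, ∀ a b : ℝ, 0 ≤ a → 0 ≤ b → a + b = 1 →
      f (a • x + b • y) ≤ (a : EReal) * f x + (b : EReal) * f y)
    (hgconv : ∀ x y : H, ∀ a b : ℝ, 0 ≤ a → 0 ≤ b → a + b = 1 →
      g (a • x + b • y) ≤ (a : EReal) * g x + (b : EReal) * g y)
    (hflsc : LowerSemicontinuous f) (hglsc : LowerSemicontinuous g)
    {lam : ℝ} (hlam : 0 < lam)
    (proxf proxg : H → H)
    (hproxf : ∀ x u : H, proxObj M lam f x (proxf x) ≤ proxObj M lam f x u)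
    (hproxf_uniq : ∀ x u : H,
      (∀ v : H, proxObj M lam f x u ≤ proxObj M lam f x v) → u = proxf x)
    (hproxg : ∀ x u : H, proxObj M lam g x (proxg x) ≤ proxObj M lam g x u)
    (hproxg_uniq : ∀ x u : H,
      (∀ v : H, proxObj M lam g x u ≤ proxObj M lam g x v) → u = proxg x)
    (S : Set (H × H))
    (hS : S = {p : H × H | ∀ q : H × H, PhiFun M lam f g p ≤ PhiFun M lam f g q})
    (hSne : S.Nonempty)
    (x y : ℕ → H) (hy : ∀ n, y n = proxg (x n)) (hx : ∀ n, x (n + 1) = proxf (y n)) :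
    (∃ xb yb : H, (xb, yb) ∈ S ∧
      (∀ w : H, Tendsto (fun n : ℕ => ⟪x n, w⟫) atTop (nhds ⟪xb, w⟫)) ∧
      (∀ w : H, Tendsto (fun n : ℕ => ⟪y n, w⟫) atTop (nhds ⟪yb, w⟫))) ∧
    (∀ xb yb : H, (xb, yb) ∈ S →
      Summable (fun n : ℕ =>
        ⟪(x n - y n) - (xb - yb), M ((x n - y n) - (xb - yb))⟫) ∧
      Summable (fun n : ℕ =>
        ⟪(x (n + 1) - y n) - (xb - yb), M ((x (n + 1) - y n) - (xb - yb))⟫)) ∧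
    (∀ xb yb : H, (xb, yb) ∈ S →
      Tendsto (fun n : ℕ => y n - x n) atTop (nhds (yb - xb)) ∧
      Tendsto (fun n : ℕ => x (n + 1) - y n) atTop (nhds (xb - yb))) := by
  have hs : ∀ a b : H, ⟪a, M b⟫ = ⟪b, M a⟫ := by
    intro a b
    have h := (ContinuousLinearMap.isSelfAdjoint_iff_isSymmetric.mp hMsa) a b
    rw [← real_inner_comm b]
    exact h.symm
  have hcoer : ∀ z : H, c * ‖z‖ ^ 2 ≤ ⟪z, M z⟫ := fun z => by
    rw [real_inner_comm]; exact hM z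
  have hpos : ∀ a : H, 0 ≤ ⟪a, M a⟫ := fun a => le_trans (by positivity) (hcoer a)
  have hdef : ∀ a : H, ⟪a, M a⟫ ≤ 0 → a = 0 := by
    intro a ha
    have h1 := (hcoer a).trans ha
    have h2 : ‖a‖ ^ 2 ≤ 0 := by
      by_contra h; push Not at h; nlinarith [mul_pos hc h]
    exact norm_eq_zero.mp (pow_eq_zero_iff two_ne_zero |>.mp (le_antisymm h2 (by positivity)))
  have firmf := aux_firm M hs hlam f hfne hfnbot hfconv
  have firmg := aux_firm M hs hlam g hgne hgnbot hgconv
  have miny : ∀ n u, proxObj M lam g (x n) (y n) ≤ proxObj M lam g (x n) u := by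
    intro n u; rw [hy n]; exact hproxg _ u
  have minx : ∀ n u, proxObj M lam f (y n) (x (n + 1)) ≤ proxObj M lam f (y n) u := by
    intro n u; rw [hx n]; exact hproxf _ u
  have hSmin : ∀ xb yb : H, (xb, yb) ∈ S →
      (∀ u, proxObj M lam f yb xb ≤ proxObj M lam f yb u) ∧
      (∀ u, proxObj M lam g xb yb ≤ proxObj M lam g xb u) := by
    intro xb yb h
    rw [hS] at h
    exact aux_S_left M lam f g hfne hgne hfnbot hgnbot (xb, yb) h
  have step1 : ∀ xb yb : H, (xb, yb) ∈ S → ∀ n,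
      ⟪y n - yb, M (y n - yb)⟫ + ⟪(x n - y n) - (xb - yb), M ((x n - y n) - (xb - yb))⟫
        ≤ ⟪x n - xb, M (x n - xb)⟫ := fun xb yb h n =>
    aux_ne M hs _ _ _ _ (firmg _ _ (miny n) _ _ (hSmin xb yb h).2)
  have step2 : ∀ xb yb : H, (xb, yb) ∈ S → ∀ n,
      ⟪x (n + 1) - xb, M (x (n + 1) - xb)⟫ +
        ⟪(x (n + 1) - y n) - (xb - yb), M ((x (n + 1) - y n) - (xb - yb))⟫
        ≤ ⟪y n - yb, M (y n - yb)⟫ := by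
    intro xb yb h n
    have h1 := aux_ne M hs _ _ _ _ (firmf _ _ (minx n) _ _ (hSmin xb yb h).1)
    have e : (x (n + 1) - y n) - (xb - yb) = - ((y n - x (n + 1)) - (yb - xb)) := by abel
    rw [e, map_neg, inner_neg_neg]
    exact h1
  have hb : ∀ xb yb : H, (xb, yb) ∈ S →
      Summable (fun n : ℕ =>
        ⟪(x n - y n) - (xb - yb), M ((x n - y n) - (xb - yb))⟫) ∧
      Summable (fun n : ℕ =>
        ⟪(x (n + 1) - y n) - (xb - yb), M ((x (n + 1) - y n) - (xb - yb))⟫) := by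
    intro xb yb h
    constructor
    · refine aux_summable (fun n => ⟪x n - xb, M (x n - xb)⟫) _ (fun n => hpos _)
        (fun n => hpos _) fun n => ?_
      linarith [step1 xb yb h n, step2 xb yb h n,
        hpos ((x (n + 1) - y n) - (xb - yb))]
    · refine aux_summable (fun n => ⟪x n - xb, M (x n - xb)⟫) _ (fun n => hpos _)
        (fun n => hpos _) fun n => ?_
      linarith [step1 xb yb h n, step2 xb yb h n,
        hpos ((x n - y n) - (xb - yb))]
  have hz : ∀ z : ℕ → H, Summable (fun n => ⟪z n, M (z n)⟫) → Tendsto z atTop (nhds 0) := by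
    intro z hz
    have h1 := hz.tendsto_atTop_zero
    have h2 : Tendsto (fun n => c⁻¹ * ⟪z n, M (z n)⟫) atTop (nhds 0) := by
      simpa using h1.const_mul c⁻¹
    have h3 : Tendsto (fun n => ‖z n‖ ^ 2) atTop (nhds 0) := by
      refine squeeze_zero (fun n => by positivity) (fun n => ?_) h2
      rw [inv_mul_eq_div, le_div_iff₀ hc, mul_comm]
      exact hcoer _
    have h4 := h3.sqrt
    simp only [Real.sqrt_zero, Real.sqrt_sq (norm_nonneg _)] at h4
    exact tendsto_zero_iff_norm_tendsto_zero.mpr h4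
  have hc' : ∀ xb yb : H, (xb, yb) ∈ S →
      Tendsto (fun n : ℕ => y n - x n) atTop (nhds (yb - xb)) ∧
      Tendsto (fun n : ℕ => x (n + 1) - y n) atTop (nhds (xb - yb)) := by
    intro xb yb h
    constructor
    · have h1 := (hz _ (hb xb yb h).1).const_sub (yb - xb)
      rw [sub_zero] at h1
      exact h1.congr fun n => by abel
    · have h1 := (hz _ (hb xb yb h).2).add_const (xb - yb)
      rw [zero_add] at h1
      exact h1.congr fun n => by abel
  refine ⟨?_, hb, hc'⟩
  obtain ⟨⟨x0, y0⟩, h0⟩ := hSne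
  have hanti : ∀ xb yb : H, (xb, yb) ∈ S →
      Antitone (fun n => ⟪x n - xb, M (x n - xb)⟫) := by
    intro xb yb h
    refine antitone_nat_of_succ_le fun n => ?_
    linarith [step1 xb yb h n, step2 xb yb h n, hpos ((x n - y n) - (xb - yb)),
        hpos ((x (n + 1) - y n) - (xb - yb))]
  have hbd : ∀ z : H, ∀ K : ℝ, ⟪z, M z⟫ ≤ K → ‖z‖ ≤ √(K / c) := by
    intro z K h
    apply Real.le_sqrt_of_sq_le
    rw [le_div_iff₀ hc, mul_comm]
    exact (hcoer z).trans h
  set K := ⟪x 0 - x0, M (x 0 - x0)⟫ with hK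
  have hxK : ∀ n, ⟪x n - x0, M (x n - x0)⟫ ≤ K := fun n => hanti x0 y0 h0 (Nat.zero_le n)
  have hyK : ∀ n, ⟪y n - y0, M (y n - y0)⟫ ≤ K := fun n => by
    linarith [hxK n, step1 x0 y0 h0 n, hpos ((x n - y n) - (x0 - y0))]
  obtain ⟨Cx, hCx⟩ : ∃ C, ∀ n, ‖x n‖ ≤ C := ⟨√(K / c) + ‖x0‖, fun n => by
    have h1 := hbd _ _ (hxK n)
    have h2 := norm_add_le (x n - x0) x0
    rw [sub_add_cancel] at h2
    linarith⟩
  obtain ⟨Cy, hCy⟩ : ∃ C, ∀ n, ‖y n‖ ≤ C := ⟨√(K / c) + ‖y0‖, fun n => by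
    have h1 := hbd _ _ (hyK n)
    have h2 := norm_add_le (y n - y0) y0
    rw [sub_add_cancel] at h2
    linarith⟩
  obtain ⟨hc1, hc2⟩ := hc' x0 y0 h0
  have hclus : ∀ U : Ultrafilter ℕ, (U : Filter ℕ) ≤ atTop → ∃ xs : H,
      (xs, xs + (y0 - x0)) ∈ S ∧
      (∀ w, Tendsto (fun n => ⟪x n, w⟫) U (nhds ⟪xs, w⟫)) := by
    intro U hU
    obtain ⟨xs, hxs⟩ := aux_weak_compact U x Cx hCx
    refine ⟨xs, ?_, hxs⟩
    set ys := xs + (y0 - x0) with hys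
    have d1 := hc1.mono_left hU
    have d2 := hc2.mono_left hU
    have hyw : ∀ w, Tendsto (fun n => ⟪y n, w⟫) U (nhds ⟪ys, w⟫) := by
      intro w
      have h := (hxs w).add (d1.inner (tendsto_const_nhds (x := w)))
      rw [← inner_add_left] at h
      exact h.congr fun n => by rw [← inner_add_left]; congr 1; abel
    have hxw : ∀ w, Tendsto (fun n => ⟪x (n + 1), w⟫) U (nhds ⟪xs, w⟫) := by
      intro w
      have h := (hyw w).add (d2.inner (tendsto_const_nhds (x := w)))
      rw [← inner_add_left] at h
      have e : ys + (x0 - y0) = xs := by rw [hys]; abel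
      rw [e] at h
      exact h.congr fun n => by rw [← inner_add_left]; congr 1; abel
    have ey : ys = proxg xs := by
      set p := proxg xs
      have t : Tendsto (fun n => ⟪M ((x n - y n) - (xs - p)), y n - p⟫) U
          (nhds ⟪M ((xs - ys) - (xs - p)), ys - p⟫) := by
        refine aux_strong_weak _ _ _ _ (Cy + ‖p‖) ?_ ?_ ?_
        · refine (M.continuous.tendsto _).comp ?_
          refine Tendsto.sub_const ?_ _
          have h := d1.neg
          have e : -(y0 - x0) = xs - ys := by rw [hys]; abel
          rw [e] at h
          exact h.congr fun n => by abel
        · intro w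
          simpa only [inner_sub_left] using (hyw w).sub_const ⟪p, w⟫
        · intro n
          exact (norm_sub_le _ _).trans (by linarith [hCy n])
      have h := ge_of_tendsto' t fun n => firmg _ _ (miny n) _ _ (hproxg xs)
      have e : (xs - ys) - (xs - p) = -(ys - p) := by abel
      rw [e, map_neg, inner_neg_left, real_inner_comm] at h
      exact sub_eq_zero.mp (hdef _ (by linarith))
    have ex : xs = proxf ys := by
      set p := proxf ys
      have t : Tendsto (fun n => ⟪M ((y n - x (n + 1)) - (ys - p)), x (n + 1) - p⟫) U
          (nhds ⟪M ((ys - xs) - (ys - p)), xs - p⟫) := by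
        refine aux_strong_weak _ _ _ _ (Cx + ‖p‖) ?_ ?_ ?_
        · refine (M.continuous.tendsto _).comp ?_
          refine Tendsto.sub_const ?_ _
          have h := d2.neg
          have e : -(x0 - y0) = ys - xs := by rw [hys]; abel
          rw [e] at h
          exact h.congr fun n => by abel
        · intro w
          simpa only [inner_sub_left] using (hxw w).sub_const ⟪p, w⟫
        · intro n
          exact (norm_sub_le _ _).trans (by linarith [hCx (n + 1)])
      have h := ge_of_tendsto' t fun n => firmf _ _ (minx n) _ _ (hproxf ys)
      have e : (ys - xs) - (ys - p) = -(xs - p) := by abel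
      rw [e, map_neg, inner_neg_left, real_inner_comm] at h
      exact sub_eq_zero.mp (hdef _ (by linarith))
    rw [hS]
    refine aux_S_right M hs hpos hlam f g hfne hfnbot hgne hgnbot hfconv hgconv xs ys ?_ ?_
    · intro u; rw [ex]; exact hproxf ys u
    · intro u; rw [ey]; exact hproxg xs u
  have hlim : ∀ p q : H, (p, q) ∈ S → ∃ l,
      Tendsto (fun n => ⟪x n - p, M (x n - p)⟫) atTop (nhds l) := fun p q h =>
    ⟨_, tendsto_atTop_ciInf (hanti p q h) ⟨0, by rintro _ ⟨n, rfl⟩; exact hpos _⟩⟩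
  have huniq : ∀ (U V : Ultrafilter ℕ) (p p' : H), (U : Filter ℕ) ≤ atTop →
      (V : Filter ℕ) ≤ atTop → (p, p + (y0 - x0)) ∈ S → (p', p' + (y0 - x0)) ∈ S →
      (∀ w, Tendsto (fun n => ⟪x n, w⟫) U (nhds ⟪p, w⟫)) →
      (∀ w, Tendsto (fun n => ⟪x n, w⟫) V (nhds ⟪p', w⟫)) → p = p' := by
    intro U V p p' hU hV hp hp' h1 h2
    obtain ⟨l, hl⟩ := hlim _ _ hp
    obtain ⟨l', hl'⟩ := hlim _ _ hp'
    have h3 : Tendsto (fun n => ⟪x n, M (p - p')⟫) atTop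
        (nhds ((l' - l + ⟪p, M p⟫ - ⟪p', M p'⟫) / 2)) := by
      refine ((((hl'.sub hl).add_const ⟪p, M p⟫).sub_const ⟪p', M p'⟫).div_const 2).congr
        fun n => ?_
      simp only [map_sub, inner_sub_left, inner_sub_right]
      rw [hs p (x n), hs p' (x n)]
      ring
    have e1 := tendsto_nhds_unique (h1 _) (h3.mono_left hU)
    have e2 := tendsto_nhds_unique (h2 _) (h3.mono_left hV)
    apply sub_eq_zero.mp
    apply hdef
    rw [inner_sub_left]
    linarith
  obtain ⟨xs, hxsS, hxs⟩ := hclus (Ultrafilter.of atTop) (Ultrafilter.of_le atTop)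
  have hw : ∀ w : H, Tendsto (fun n : ℕ => ⟪x n, w⟫) atTop (nhds ⟪xs, w⟫) := by
    intro w
    rw [tendsto_iff_ultrafilter]
    intro V hV
    obtain ⟨p, hpS, hp⟩ := hclus V hV
    have := huniq _ V xs p (Ultrafilter.of_le atTop) hV hxsS hpS hxs hp
    rw [this]
    exact hp w
  refine ⟨xs, xs + (y0 - x0), hxsS, hw, fun w => ?_⟩
  have h := (hw w).add (hc1.inner (tendsto_const_nhds (x := w)))
  rw [← inner_add_left] at h
  exact h.congr fun n => by rw [← inner_add_left]; congr 1; abel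
end
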